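/- arXiv:2304.13523 — 12 statements merged into one kernel-verified Lean document; each statement's English description precedes it below -/
import Mathlib

section
/- A is spanned by simultaneous eigenvectors with strictly positive eigenvalues: the set of elements a ∈ A for which there exist strictly positive real numbers λ₁, λ₂, λ₃, λ₄, λ₅ with S(S a) = λ₁ • a, σ(a) = λ₂ • a, σ'(a) = λ₃ • a, δ * a = λ₄ • a and a * δ = λ₅ • a spans A as a ℂ-vector space. -/
open TensorProduct HopfAlgebra Coalgebra ComplexOrder

section AQGHelpers

theorem aqg_diag {V : Type*} [AddCommGroup V] [Module ℂ V] [FiniteDimensional ℂ V]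
    (c : InnerProductSpace.Core ℂ V) (f g : V →ₗ[ℂ] V)
    (hf : ∀ x y, c.inner (f x) y = c.inner x (f y))
    (hg : ∀ x y, c.inner (g x) y = c.inner x (g y)) (hfg : Commute f g) :
    (⨆ α, ⨆ γ, Module.End.eigenspace f α ⊓ Module.End.eigenspace g γ) = ⊤ := by
  let : NormedAddCommGroup V := c.toNormedAddCommGroup
  let : InnerProductSpace ℂ V := InnerProductSpace.ofCore c.toCore
  exact LinearMap.IsSymmetric.iSup_iSup_eigenspace_inf_eigenspace_eq_top_of_commute
    (A := f) (B := g) hf hg hfg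

variable {A : Type*} [AddCommGroup A] [Module ℂ A] [Coalgebra ℂ A]

theorem aqg_right (k : A →ₗ[ℂ] A) (w : A →ₗ[ℂ] ℂ)
    (hk : ∀ a, k a = TensorProduct.rid ℂ A (LinearMap.lTensor A w (comul (R := ℂ) a))) (a : A) :
    comul (R := ℂ) (k a) = LinearMap.lTensor A k (comul (R := ℂ) a) := by
  have h1 : ∀ t : A ⊗[ℂ] A, comul (R := ℂ) (TensorProduct.rid ℂ A (LinearMap.lTensor A w t))
      = TensorProduct.rid ℂ (A ⊗[ℂ] A) (LinearMap.lTensor (A ⊗[ℂ] A) w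
        (LinearMap.rTensor A (comul (R := ℂ)) t)) := by
    intro t
    induction t with
    | zero => simp
    | tmul x y => simp
    | add x y hx hy => simp only [map_add, hx, hy]
  have h2 : ∀ u : A ⊗[ℂ] (A ⊗[ℂ] A), TensorProduct.rid ℂ (A ⊗[ℂ] A)
      (LinearMap.lTensor (A ⊗[ℂ] A) w ((TensorProduct.assoc ℂ A A A).symm u))
      = LinearMap.lTensor A ((TensorProduct.rid ℂ A).toLinearMap ∘ₗ LinearMap.lTensor A w) u := by
    intro u
    induction u with
    | zero => simp
    | tmul x y =>
      induction y with
      | zero => simp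
      | tmul y z => simp
      | add y z hy hz => simp only [TensorProduct.tmul_add, map_add, hy, hz]
    | add x y hx hy => simp only [map_add, hx, hy]
  have h3 : k = ((TensorProduct.rid ℂ A).toLinearMap ∘ₗ LinearMap.lTensor A w) ∘ₗ
      comul (R := ℂ) := LinearMap.ext hk
  rw [hk, h1, ← Coalgebra.coassoc_symm_apply, h2, h3, ← LinearMap.comp_apply, ← LinearMap.lTensor_comp]

theorem aqg_left (k : A →ₗ[ℂ] A) (w : A →ₗ[ℂ] ℂ)
    (hk : ∀ a, k a = TensorProduct.lid ℂ A (LinearMap.rTensor A w (comul (R := ℂ) a))) (a : A) :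
    comul (R := ℂ) (k a) = LinearMap.rTensor A k (comul (R := ℂ) a) := by
  have h1 : ∀ t : A ⊗[ℂ] A, comul (R := ℂ) (TensorProduct.lid ℂ A (LinearMap.rTensor A w t))
      = TensorProduct.lid ℂ (A ⊗[ℂ] A) (LinearMap.rTensor (A ⊗[ℂ] A) w
        (LinearMap.lTensor A (comul (R := ℂ)) t)) := by
    intro t
    induction t with
    | zero => simp
    | tmul x y => simp
    | add x y hx hy => simp only [map_add, hx, hy]
  have h2 : ∀ u : (A ⊗[ℂ] A) ⊗[ℂ] A, TensorProduct.lid ℂ (A ⊗[ℂ] A)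
      (LinearMap.rTensor (A ⊗[ℂ] A) w ((TensorProduct.assoc ℂ A A A) u))
      = LinearMap.rTensor A ((TensorProduct.lid ℂ A).toLinearMap ∘ₗ LinearMap.rTensor A w) u := by
    intro u
    induction u with
    | zero => simp
    | tmul y x =>
      induction y with
      | zero => simp
      | tmul y z => simp [TensorProduct.smul_tmul']
      | add y z hy hz => simp only [TensorProduct.add_tmul, map_add, hy, hz]
    | add x y hx hy => simp only [map_add, hx, hy]
  have h3 : k = ((TensorProduct.lid ℂ A).toLinearMap ∘ₗ LinearMap.rTensor A w) ∘ₗ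
      comul (R := ℂ) := LinearMap.ext hk
  rw [hk, h1, ← Coalgebra.coassoc_apply, h2, h3, ← LinearMap.comp_apply, ← LinearMap.rTensor_comp]

theorem aqg_right_fin (k : A →ₗ[ℂ] A)
    (hk : ∀ a, comul (R := ℂ) (k a) = LinearMap.lTensor A k (comul (R := ℂ) a)) (a : A) :
    ∃ s : Finset A, ∀ n : ℕ, (k ^ n) a ∈ Submodule.span ℂ (s : Set A) := by
  classical
  have hp : ∀ n : ℕ, ∀ a, comul (R := ℂ) ((k ^ n) a)
      = LinearMap.lTensor A (k ^ n) (comul (R := ℂ) a) := by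
    intro n
    induction n with
    | zero => intro a; simp [Module.End.one_eq_id]
    | succ n ih =>
      intro a
      rw [pow_succ, Module.End.mul_apply, ih, hk, Module.End.mul_eq_comp, LinearMap.lTensor_comp]
      rfl
  refine ⟨(ℛ ℂ a).index.image (ℛ ℂ a).left, fun n => ?_⟩
  have h := congrArg (TensorProduct.rid ℂ A)
    (Coalgebra.lTensor_counit_comul (R := ℂ) ((k ^ n) a))
  rw [hp, ← (ℛ ℂ a).eq] at h
  simp only [map_sum, LinearMap.lTensor_tmul, TensorProduct.rid_tmul, one_smul] at h
  rw [← h]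
  refine Submodule.sum_mem _ fun i hi => Submodule.smul_mem _ _ (Submodule.subset_span ?_)
  simpa using ⟨i.1, i.2, hi, rfl⟩

theorem aqg_left_fin (k : A →ₗ[ℂ] A)
    (hk : ∀ a, comul (R := ℂ) (k a) = LinearMap.rTensor A k (comul (R := ℂ) a)) (a : A) :
    ∃ s : Finset A, ∀ n : ℕ, (k ^ n) a ∈ Submodule.span ℂ (s : Set A) := by
  classical
  have hp : ∀ n : ℕ, ∀ a, comul (R := ℂ) ((k ^ n) a)
      = LinearMap.rTensor A (k ^ n) (comul (R := ℂ) a) := by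
    intro n
    induction n with
    | zero => intro a; simp [Module.End.one_eq_id]
    | succ n ih =>
      intro a
      rw [pow_succ, Module.End.mul_apply, ih, hk, Module.End.mul_eq_comp, LinearMap.rTensor_comp]
      rfl
  refine ⟨(ℛ ℂ a).index.image (ℛ ℂ a).right, fun n => ?_⟩
  have h := congrArg (TensorProduct.lid ℂ A)
    (Coalgebra.rTensor_counit_comul (R := ℂ) ((k ^ n) a))
  rw [hp, ← (ℛ ℂ a).eq] at h
  simp only [map_sum, LinearMap.rTensor_tmul, TensorProduct.lid_tmul, one_smul] at h
  rw [← h]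
  refine Submodule.sum_mem _ fun i hi => Submodule.smul_mem _ _ (Submodule.subset_span ?_)
  simpa using ⟨i.1, i.2, hi, rfl⟩

theorem aqg_fd (k k' : A →ₗ[ℂ] A)
    (hk : ∀ a, comul (R := ℂ) (k a) = LinearMap.lTensor A k (comul (R := ℂ) a))
    (hk' : ∀ a, comul (R := ℂ) (k' a) = LinearMap.rTensor A k' (comul (R := ℂ) a))
    (hc : Commute k k') (a : A) :
    ∃ W : Submodule ℂ A, FiniteDimensional ℂ W ∧ a ∈ W ∧ (∀ x ∈ W, k x ∈ W) ∧
      (∀ x ∈ W, k' x ∈ W) := by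
  classical
  obtain ⟨s, hs⟩ := aqg_right_fin k hk a
  choose t ht using fun x => aqg_left_fin k' hk' x
  let U : Submodule ℂ A := Submodule.span ℂ ((s.biUnion t : Finset A) : Set A)
  have hU : ∀ m n : ℕ, (k' ^ m) ((k ^ n) a) ∈ U := by
    intro m n
    have : Submodule.span ℂ (s : Set A) ≤ U.comap (k' ^ m) := by
      rw [Submodule.span_le]
      intro x hx
      refine Submodule.span_mono ?_ (ht x m)
      intro y hy
      simp only [Finset.coe_biUnion, Set.mem_iUnion]
      exact ⟨x, hx, hy⟩
    exact this (hs n)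
  let W : Submodule ℂ A := Submodule.span ℂ
    (Set.range fun p : ℕ × ℕ => (k' ^ p.1) ((k ^ p.2) a))
  have hWU : W ≤ U := by
    rw [Submodule.span_le]
    rintro _ ⟨p, rfl⟩
    exact hU _ _
  have : FiniteDimensional ℂ U := FiniteDimensional.span_finset ℂ _
  refine ⟨W, Submodule.finiteDimensional_of_le hWU, ?_, ?_, ?_⟩
  · exact Submodule.subset_span ⟨(0, 0), by simp⟩
  · have : W ≤ W.comap k := by
      rw [Submodule.span_le]
      rintro _ ⟨p, rfl⟩
      refine Submodule.subset_span ⟨(p.1, p.2 + 1), ?_⟩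
      have := (hc.pow_right p.1).eq
      have := LinearMap.congr_fun this ((k ^ p.2) a)
      simp only [Module.End.mul_apply] at this
      simp only [pow_succ', Module.End.mul_apply, this]
    exact this
  · have : W ≤ W.comap k' := by
      rw [Submodule.span_le]
      rintro _ ⟨p, rfl⟩
      refine Submodule.subset_span ⟨(p.1 + 1, p.2), ?_⟩
      simp only [pow_succ', Module.End.mul_apply]
    exact this

end AQGHelpers

section AQGCore

variable {A : Type*} [Ring A] [HopfAlgebra ℂ A] [StarRing A] [StarModule ℂ A]

theorem aqg_herm (ψ : A →ₗ[ℂ] ℂ) (hψ_pos : ∀ a : A, 0 ≤ ψ (star a * a)) (x : A) :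
    ψ (star x) = starRingEnd ℂ (ψ x) := by
  have h1 := (Complex.nonneg_iff.1 (hψ_pos (1 + x))).2
  have h2 := (Complex.nonneg_iff.1 (hψ_pos (1 + Complex.I • x))).2
  have h3 := (Complex.nonneg_iff.1 (hψ_pos 1)).2
  have h4 := (Complex.nonneg_iff.1 (hψ_pos x)).2
  simp only [star_add, star_one, star_smul, add_mul, mul_add, one_mul, mul_one, map_add, map_smul,
    Complex.add_im, smul_mul_assoc, mul_smul_comm, smul_eq_mul, smul_smul, Complex.mul_im,
    Complex.star_def, Complex.conj_I, Complex.neg_im, Complex.neg_re, Complex.I_re,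
    Complex.I_im, Complex.mul_re] at h1 h2 h3 h4
  apply Complex.ext
  · simp only [Complex.conj_re]; linarith
  · simp only [Complex.conj_im]; linarith

/-- The inner product defined by a faithful positive functional. -/
noncomputable def aqgInner (ψ : A →ₗ[ℂ] ℂ) (hψ_pos : ∀ a : A, 0 ≤ ψ (star a * a))
    (hψ_faithful : ∀ a : A, ψ (star a * a) = 0 → a = 0) (W : Submodule ℂ A) :
    InnerProductSpace.Core ℂ W where
  inner a b := ψ (star (a : A) * b)
  conj_inner_symm a b := by
    rw [← aqg_herm ψ hψ_pos, star_mul, star_star]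
  re_inner_nonneg a := (Complex.nonneg_iff.1 (hψ_pos a)).1
  add_left a b c := by simp [add_mul]
  smul_left a b r := by simp
  definite a h := by
    have := hψ_faithful a h
    exact Subtype.ext this

theorem aqg_ext (ψ : A →ₗ[ℂ] ℂ)
    (hψ_faithful : ∀ a : A, ψ (star a * a) = 0 → a = 0) (x y : A)
    (h : ∀ b, ψ (b * x) = ψ (b * y)) : x = y := by
  rw [← sub_eq_zero]
  apply hψ_faithful
  rw [mul_sub, map_sub, h, sub_self]

/-- Eigenvalues of an operator with spanning positive eigenvectors are positive. -/
theorem aqg_pos_eig {V : Type*} [AddCommGroup V] [Module ℂ V] (T : V →ₗ[ℂ] V)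
    (hT : ∀ x : V, x ∈ Submodule.span ℂ {v : V | ∃ l : ℝ, 0 < l ∧ T v = (l : ℂ) • v})
    (c : ℂ) (v : V) (hv : v ≠ 0) (hTv : T v = c • v) : ∃ l : ℝ, 0 < l ∧ c = l := by
  by_contra hc
  have hind := (Module.End.eigenspaces_iSupIndep T) c
  have : Submodule.span ℂ {v : V | ∃ l : ℝ, 0 < l ∧ T v = (l : ℂ) • v} ≤
      ⨆ j, ⨆ (_ : j ≠ c), Module.End.eigenspace T j := by
    rw [Submodule.span_le]
    rintro w ⟨l, hl, hw⟩
    have hlc : (l : ℂ) ≠ c := fun h => hc ⟨l, hl, h.symm⟩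
    exact (le_iSup₂_of_le (f := fun j (_ : j ≠ c) => Module.End.eigenspace T j) (l : ℂ) hlc
      le_rfl) (Module.End.mem_eigenspace_iff.2 hw)
  exact hv (Submodule.disjoint_def.1 hind v (Module.End.mem_eigenspace_iff.2 hTv) (this (hT v)))

theorem aqg_core (ψ : A →ₗ[ℂ] ℂ) (hψ_pos : ∀ a : A, 0 ≤ ψ (star a * a))
    (hψ_faithful : ∀ a : A, ψ (star a * a) = 0 → a = 0)
    (σ : A ≃ₐ[ℂ] A) (hσ : ∀ a b : A, ψ (a * b) = ψ (b * σ a))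
    (S : A →ₗ[ℂ] A) (hSsym : ∀ a b : A, ψ (star (S a) * b) = ψ (star a * S b))
    (hSinj : ∀ a, S a = 0 → a = 0) (hcomm : ∀ a, σ (S a) = S (σ a))
    (hΔ : ∀ a : A, comul (R := ℂ) (S a)
        = (TensorProduct.map σ.toLinearMap σ.symm.toLinearMap) (comul (R := ℂ) a)) (a : A) :
    a ∈ Submodule.span ℂ {a : A | ∃ l₁ l₂ : ℝ, 0 < l₁ ∧ 0 < l₂ ∧ S a = (l₁ : ℂ) • a ∧
      σ a = (l₂ : ℂ) • a} := by
  have herm := aqg_herm ψ hψ_pos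
  have hcomm' : ∀ a, σ.symm (S a) = S (σ.symm a) := by
    intro a
    rw [AlgEquiv.symm_apply_eq, hcomm, AlgEquiv.apply_symm_apply]
  have hσsym : ∀ a b : A, ψ (star (σ a) * b) = ψ (star a * σ b) := by
    intro a b
    rw [← hσ, ← star_star b, ← star_mul, herm, star_star, ← hσ, ← herm, star_mul, star_star]
  have hσsym' : ∀ a b : A, ψ (star (σ.symm a) * b) = ψ (star a * σ.symm b) := by
    intro a b
    have := hσsym (σ.symm a) (σ.symm b)
    simp only [AlgEquiv.apply_symm_apply] at this
    exact this.symm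
  let k : A →ₗ[ℂ] A := σ.symm.toLinearMap ∘ₗ S
  let k' : A →ₗ[ℂ] A := σ.toLinearMap ∘ₗ S
  have hk : ∀ a, comul (R := ℂ) (k a) = LinearMap.lTensor A k (comul (R := ℂ) a) := by
    refine aqg_right k (counit (R := ℂ) ∘ₗ σ.symm.toLinearMap) fun a => ?_
    have h := congrArg (TensorProduct.rid ℂ A)
      (Coalgebra.lTensor_counit_comul (R := ℂ) (S a))
    rw [hΔ] at h
    simp only [TensorProduct.rid_tmul, one_smul] at h
    change σ.symm (S a) = _
    rw [← h, AlgEquiv.symm_apply_eq]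
    generalize (comul (R := ℂ) a) = t
    induction t with
    | zero => simp
    | tmul x y => simp
    | add x y hx hy => simp only [map_add, hx, hy]
  have hk' : ∀ a, comul (R := ℂ) (k' a) = LinearMap.rTensor A k' (comul (R := ℂ) a) := by
    refine aqg_left k' (counit (R := ℂ) ∘ₗ σ.toLinearMap) fun a => ?_
    have h := congrArg (TensorProduct.lid ℂ A)
      (Coalgebra.rTensor_counit_comul (R := ℂ) (S a))
    rw [hΔ] at h
    simp only [TensorProduct.lid_tmul, one_smul] at h
    change σ (S a) = _
    rw [← h]
    generalize (comul (R := ℂ) a) = t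
    induction t with
    | zero => simp
    | tmul x y => simp
    | add x y hx hy => simp only [map_add, hx, hy]
  have hkk' : Commute k k' := by
    refine LinearMap.ext fun x => ?_
    change σ.symm (S (σ (S x))) = σ (S (σ.symm (S x)))
    rw [← hcomm, ← hcomm']
    simp
  -- joint eigenvectors of k and k'
  have step1 : ∀ (x : A) (α β : ℂ), k x = α • x → k' x = β • x →
      ∃ l : ℝ, ∃ c : ℂ, 0 < l ∧ S x = c • x ∧ σ x = (l : ℂ) • x := by
    intro x α β h1 h2
    by_cases hx : x = 0
    · exact ⟨1, 1, one_pos, by simp [hx], by simp [hx]⟩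
    have hα : α ≠ 0 := by
      rintro rfl
      rw [zero_smul] at h1
      change σ.symm (S x) = 0 at h1
      rw [AlgEquiv.symm_apply_eq, map_zero] at h1
      exact hx (hSinj _ h1)
    have e1 : S x = α • σ x := by
      change σ.symm (S x) = _ at h1
      rw [AlgEquiv.symm_apply_eq, map_smul] at h1
      exact h1
    have e2 : σ (σ x) = (α⁻¹ * β) • x := by
      change σ (S x) = _ at h2
      rw [e1, map_smul] at h2
      rw [mul_smul, ← h2, smul_smul, inv_mul_cancel₀ hα, one_smul]
    have hpos : ∀ y : A, y ≠ 0 → 0 < ψ (star y * y) := fun y hy =>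
      lt_of_le_of_ne (hψ_pos y) fun h => hy (hψ_faithful y h.symm)
    have e3 : ψ (star (σ x) * σ x) = (α⁻¹ * β) * ψ (star x * x) := by
      rw [hσsym, e2, mul_smul_comm, map_smul, smul_eq_mul]
    have hσx : σ x ≠ 0 := by simpa using hx
    have p1 := hpos _ hσx
    have p2 := hpos _ hx
    have hc : 0 < α⁻¹ * β := by
      have : α⁻¹ * β = ψ (star (σ x) * σ x) * (ψ (star x * x))⁻¹ := by
        rw [e3, mul_assoc, mul_inv_cancel₀ p2.ne', mul_one]
      rw [this]
      exact mul_pos p1 (inv_pos.2 p2)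
    obtain ⟨c, hc0, hcc⟩ : ∃ c : ℝ, 0 < c ∧ α⁻¹ * β = c := by
      obtain ⟨q1, q2⟩ := Complex.pos_iff.1 hc
      exact ⟨(α⁻¹ * β).re, q1, Complex.ext (by simp) (by simp [← q2])⟩
    have hm : 0 < √c := Real.sqrt_pos.2 hc0
    have hmm : ((√c : ℝ) : ℂ) * (√c : ℝ) = c := by
      rw [← Complex.ofReal_mul, Real.mul_self_sqrt hc0.le]
    have e4 : σ x = ((√c : ℝ) : ℂ) • x := by
      rw [← sub_eq_zero]
      by_contra hb
      set b := σ x - ((√c : ℝ) : ℂ) • x with hbdef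
      have hb1 : σ b = -(((√c : ℝ) : ℂ) • b) := by
        rw [hbdef, map_sub, map_smul, e2, hcc, smul_sub, smul_smul, hmm]
        abel
      have hb2 : 0 ≤ ψ (star b * σ b) := by
        rw [← hσ]
        simpa using hψ_pos (star b)
      rw [hb1, mul_neg, mul_smul_comm, map_neg, map_smul, smul_eq_mul] at hb2
      have : 0 < ((√c : ℝ) : ℂ) * ψ (star b * b) :=
        mul_pos (by exact_mod_cast hm) (hpos b hb)
      exact absurd (neg_nonneg.1 hb2) (not_le_of_gt this)
    refine ⟨√c, α * (√c : ℝ), hm, ?_, e4⟩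
    rw [e1, e4, smul_smul]
  have step2 : ∀ a : A, a ∈ Submodule.span ℂ {x : A | ∃ l : ℝ, ∃ c : ℂ, 0 < l ∧ S x = c • x ∧
      σ x = (l : ℂ) • x} := by
    intro a
    obtain ⟨W, hWfd, haW, hWk, hWk'⟩ := aqg_fd k k' hk hk' hkk' a
    have hd := aqg_diag (aqgInner ψ hψ_pos hψ_faithful W) (k.restrict hWk) (k'.restrict hWk')
      (fun x y => by
        change ψ (star (σ.symm (S x)) * y) = ψ (star (x : A) * σ.symm (S y))
        rw [hσsym', hSsym, hcomm'])
      (fun x y => by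
        change ψ (star (σ (S x)) * y) = ψ (star (x : A) * σ (S y))
        rw [hσsym, hSsym, hcomm])
      (by
        refine LinearMap.ext fun x => Subtype.ext ?_
        exact LinearMap.congr_fun hkk' (x : A))
    have hle : (⊤ : Submodule ℂ W) ≤ (Submodule.span ℂ {x : A | ∃ l : ℝ, ∃ c : ℂ, 0 < l ∧
        S x = c • x ∧ σ x = (l : ℂ) • x}).comap W.subtype := by
      rw [← hd]
      refine iSup_le fun α => iSup_le fun β => ?_
      rintro x ⟨h1, h2⟩
      have h1 := congrArg Subtype.val (Module.End.mem_eigenspace_iff.1 h1)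
      have h2 := congrArg Subtype.val (Module.End.mem_eigenspace_iff.1 h2)
      exact Submodule.subset_span (step1 x α β h1 h2)
    exact hle (x := ⟨a, haW⟩) trivial
  have step3 : ∀ z : A ⊗[ℂ] A, z ∈ Submodule.span ℂ {v : A ⊗[ℂ] A | ∃ l : ℝ, 0 < l ∧
      TensorProduct.map σ.toLinearMap σ.symm.toLinearMap v = (l : ℂ) • v} := by
    intro z
    induction z with
    | zero => exact zero_mem _
    | add x y hx hy => exact add_mem hx hy
    | tmul x y =>
      induction step2 x using Submodule.span_induction with
      | zero => simp
      | add x x' _ _ hx hx' => rw [TensorProduct.add_tmul]; exact add_mem hx hx'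
      | smul c x _ hx => rw [← TensorProduct.smul_tmul']; exact Submodule.smul_mem _ _ hx
      | mem x hx =>
        induction step2 y using Submodule.span_induction with
        | zero => simp
        | add y y' _ _ hy hy' => rw [TensorProduct.tmul_add]; exact add_mem hy hy'
        | smul c y _ hy => rw [TensorProduct.tmul_smul]; exact Submodule.smul_mem _ _ hy
        | mem y hy =>
          obtain ⟨l, _, hl, _, hx⟩ := hx
          obtain ⟨m, _, hm, _, hy⟩ := hy
          refine Submodule.subset_span ⟨l * m⁻¹, by positivity, ?_⟩
          have hm' : (m : ℂ) ≠ 0 := by exact_mod_cast hm.ne'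
          have hy' : σ.symm y = (m : ℂ)⁻¹ • y := by
            rw [AlgEquiv.symm_apply_eq, map_smul, hy, smul_smul, inv_mul_cancel₀ hm', one_smul]
          rw [TensorProduct.map_tmul]
          change σ x ⊗ₜ[ℂ] σ.symm y = _
          rw [hx, hy', TensorProduct.smul_tmul_smul]
          push_cast
          rfl
  refine Submodule.span_mono ?_ (step2 a)
  rintro x ⟨l, c, hl, hS, hσx⟩
  by_cases hx : x = 0
  · exact ⟨1, 1, one_pos, one_pos, by simp [hx], by simp [hx]⟩
  have hΔx : comul (R := ℂ) x ≠ 0 := by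
    intro h
    have := congrArg (TensorProduct.rid ℂ A) (Coalgebra.lTensor_counit_comul (R := ℂ) x)
    rw [h] at this
    simp at this
    exact hx this.symm
  obtain ⟨m, hm, rfl⟩ := aqg_pos_eig _ step3 c _ hΔx (by rw [← hΔ, hS, map_smul])
  exact ⟨m, l, hm, hl, hS, hσx⟩

end AQGCore

/-- A `*`-algebraic quantum group `A` (here: a Hopf `*`-algebra over `ℂ` with a
faithful positive right integral `ψ`, modular automorphisms `σ'` and `σ`, and modular element `δ`)
is spanned by simultaneous eigenvectors, with strictly positive eigenvalues, of the maps
`S²`, `σ`, `σ'` and left and right multiplication by `δ`. -/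
theorem algebraic_quantum_group_spanned_by_positive_eigenvectors
    {A : Type*} [Ring A] [HopfAlgebra ℂ A] [StarRing A] [StarModule ℂ A]
    -- compatibility of the comultiplication with the star structure:
    -- `st` is the (well-defined) conjugate-linear map `p ⊗ q ↦ star p ⊗ star q`
    (st : A ⊗[ℂ] A → A ⊗[ℂ] A)
    (hst_add : ∀ z w : A ⊗[ℂ] A, st (z + w) = st z + st w)
    (hst_smul : ∀ (c : ℂ) (z : A ⊗[ℂ] A), st (c • z) = (starRingEnd ℂ c) • st z)
    (hst_tmul : ∀ p q : A, st (p ⊗ₜ[ℂ] q) = (star p) ⊗ₜ[ℂ] (star q))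
    (hcomul_star : ∀ a : A, comul (R := ℂ) (star a) = st (comul (R := ℂ) a))
    -- the antipode is bijective: `Se` is `S` as a linear equivalence
    (Se : A ≃ₗ[ℂ] A) (hSe : ∀ a : A, Se a = antipode (R := ℂ) a)
    (hstar_S : ∀ a : A, star (antipode (R := ℂ) a) = Se.symm (star a))
    -- `ψ` is a faithful positive right integral
    (ψ : A →ₗ[ℂ] ℂ)
    (hψ_inv : ∀ a : A,
      (TensorProduct.lid ℂ A) ((TensorProduct.map ψ LinearMap.id) (comul (R := ℂ) a))
        = ψ a • (1 : A))
    (hψ_pos : ∀ a : A, 0 ≤ ψ (star a * a))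
    (hψ_faithful : ∀ a : A, ψ (star a * a) = 0 → a = 0)
    -- `σ'` is the modular automorphism of `ψ`
    (σ' : A ≃ₐ[ℂ] A)
    (hσ' : ∀ a b : A, ψ (a * b) = ψ (b * σ' a))
    -- `φ := ψ ∘ S` is a positive left integral, with modular automorphism `σ`
    (hφ_inv : ∀ a : A,
      (TensorProduct.rid ℂ A)
          ((TensorProduct.map LinearMap.id (ψ ∘ₗ antipode (R := ℂ))) (comul (R := ℂ) a))
        = ψ (antipode (R := ℂ) a) • (1 : A))
    (hφ_pos : ∀ a : A, 0 ≤ ψ (antipode (R := ℂ) (star a * a)))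
    (σ : A ≃ₐ[ℂ] A)
    (hσ : ∀ a b : A, ψ (antipode (R := ℂ) (a * b)) = ψ (antipode (R := ℂ) (b * σ a)))
    -- `δ` is the modular element
    (δ : Aˣ)
    (hδ_comul : comul (R := ℂ) (δ : A) = (δ : A) ⊗ₜ[ℂ] (δ : A))
    (hδ_S : antipode (R := ℂ) (δ : A) = ((δ⁻¹ : Aˣ) : A))
    (hδ_star : star (δ : A) = (δ : A))
    (hδ_σ : σ (δ : A) = (δ : A))
    (hδ_σ' : σ' (δ : A) = (δ : A))
    (hψS : ∀ a : A, ψ (antipode (R := ℂ) a) = ψ (a * ((δ⁻¹ : Aˣ) : A)))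
    (hψφ : ∀ a : A, ψ a = ψ (antipode (R := ℂ) (a * (δ : A))))
    -- a self-adjoint square root of `δ`
    (d : A) (hd_star : star d = d) (hd_sq : d * d = (δ : A))
    -- the standard commutation relations
    (hcomm_σσ' : ∀ a : A, σ (σ' a) = σ' (σ a))
    (hcomm_S2σ : ∀ a : A,
      σ (antipode (R := ℂ) (antipode (R := ℂ) a))
        = antipode (R := ℂ) (antipode (R := ℂ) (σ a)))
    (hcomm_S2σ' : ∀ a : A,
      σ' (antipode (R := ℂ) (antipode (R := ℂ) a))
        = antipode (R := ℂ) (antipode (R := ℂ) (σ' a)))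
    (hΔS2 : ∀ a : A,
      comul (R := ℂ) (antipode (R := ℂ) (antipode (R := ℂ) a))
        = (TensorProduct.map σ.toLinearMap σ'.symm.toLinearMap) (comul (R := ℂ) a))
    (hσσ'δ : ∀ a : A, σ (σ' a) = (δ : A) * σ (σ a) * ((δ⁻¹ : Aˣ) : A)) :
    Submodule.span ℂ {a : A | ∃ l₁ l₂ l₃ l₄ l₅ : ℝ,
        0 < l₁ ∧ 0 < l₂ ∧ 0 < l₃ ∧ 0 < l₄ ∧ 0 < l₅ ∧
        antipode (R := ℂ) (antipode (R := ℂ) a) = (l₁ : ℂ) • a ∧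
        σ a = (l₂ : ℂ) • a ∧ σ' a = (l₃ : ℂ) • a ∧
        (δ : A) * a = (l₄ : ℂ) • a ∧ a * (δ : A) = (l₅ : ℂ) • a} = ⊤ := by
  have hmain : ∀ a : A, ψ (antipode ℂ a) = ψ a := by
    by_cases h1 : (1 : A) = 0
    · intro a
      have : ∀ x : A, x = 0 := fun x => by rw [← mul_one x, h1, mul_zero]
      rw [this (antipode ℂ a), this a]
    · intro a
      have hψ1 : ψ 1 ≠ 0 := fun h => h1 (hψ_faithful 1 (by simpa using h))
      have e1 := congrArg (fun x => ψ (antipode ℂ x)) (hψ_inv a)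
      have e2 := congrArg ψ (hφ_inv a)
      have e3 : ∀ t : A ⊗[ℂ] A, ψ (antipode ℂ ((TensorProduct.lid ℂ A)
          ((TensorProduct.map ψ LinearMap.id) t))) = ψ ((TensorProduct.rid ℂ A)
          ((TensorProduct.map LinearMap.id (ψ ∘ₗ antipode ℂ)) t)) := by
        intro t
        induction t with
        | zero => simp
        | tmul x y => simp [mul_comm]
        | add x y hx hy => simp only [map_add, hx, hy]
      rw [e3, e2] at e1
      simp only [map_smul, antipode_one, smul_eq_mul] at e1
      exact mul_right_cancel₀ hψ1 e1
  have hδ1 : (δ : A) = 1 := by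
    have : ((δ⁻¹ : Aˣ) : A) = 1 := aqg_ext ψ hψ_faithful _ _ fun b => by
      rw [← hψS, hmain, mul_one]
    have h2 := δ.mul_inv
    rwa [this, mul_one] at h2
  simp only [hmain] at hσ
  have hσσ' : ∀ a, σ' a = σ a := fun a => aqg_ext ψ hψ_faithful _ _ fun b => by
    rw [← hσ, ← hσ']
  have hσe : σ' = σ := AlgEquiv.ext hσσ'
  subst hσe
  have hSS : ∀ x, antipode ℂ (Se.symm x) = x := fun x => by
    rw [← hSe, LinearEquiv.apply_symm_apply]
  have key := aqg_core ψ hψ_pos hψ_faithful σ' hσ (antipode ℂ ∘ₗ antipode ℂ)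
    (fun a b => by
      simp only [LinearMap.comp_apply]
      rw [hstar_S, hstar_S]
      conv_rhs => rw [← hSS (star a), ← hSS (Se.symm (star a))]
      rw [← antipode_mul_antidistrib, ← antipode_mul_antidistrib, hmain, hmain])
    (fun a h => by
      simp only [LinearMap.comp_apply, ← hSe] at h
      simpa using h)
    hcomm_S2σ hΔS2
  refine (Submodule.eq_top_iff').2 fun a => Submodule.span_mono ?_ (key a)
  rintro x ⟨l₁, l₂, h1, h2, h3, h4⟩
  exact ⟨l₁, l₂, l₂, 1, 1, h1, h2, h2, one_pos, one_pos, h3, h4, h4, by simp [hδ1], by simp [hδ1]⟩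
end

section
/- A is spanned by common eigenvectors of the three maps S², σ and σ': the set of elements a ∈ A for which there exist strictly positive real numbers λ, μ, ν with S(S a) = λ • a, σ(a) = μ • a and σ'(a) = ν • a spans A as a ℂ-vector space. -/
open TensorProduct HopfAlgebra Coalgebra ComplexOrder

theorem aux_diag {A : Type*} [AddCommGroup A] [Module ℂ A] (c : InnerProductSpace.Core ℂ A)
    (T : A →ₗ[ℂ] A) (hT : ∀ x y, c.inner (T x) y = c.inner x (T y))
    (W : Submodule ℂ A) (hfd : FiniteDimensional ℂ W) (hW : ∀ x ∈ W, T x ∈ W)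
    (a : A) (ha : a ∈ W) :
    a ∈ Submodule.span ℂ {x : A | x ∈ W ∧ ∃ t : ℝ, T x = (t : ℂ) • x} := by
  let : NormedAddCommGroup A := c.toNormedAddCommGroup
  let : InnerProductSpace ℂ A := InnerProductSpace.ofCore c.toCore
  have hs : (T.restrict hW).IsSymmetric := by
    intro x y
    exact hT x y
  let b := hs.eigenvectorBasis rfl
  have h1 : (⟨a, ha⟩ : W) ∈ Submodule.span ℂ (Set.range b) := by
    rw [← b.coe_toBasis, b.toBasis.span_eq]; trivial
  have h2 := Submodule.mem_map_of_mem (f := W.subtype) h1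
  rw [Submodule.map_span] at h2
  refine Submodule.span_mono ?_ h2
  rintro _ ⟨_, ⟨i, rfl⟩, rfl⟩
  refine ⟨(b i).2, hs.eigenvalues rfl i, ?_⟩
  have := congrArg W.subtype (hs.apply_eigenvectorBasis rfl i)
  exact this

theorem aux_lf_left {C : Type*} [AddCommGroup C] [Module ℂ C] [Coalgebra ℂ C]
    (f : C →ₗ[ℂ] ℂ) (T : C →ₗ[ℂ] C)
    (hT : ∀ a, T a = TensorProduct.lid ℂ C (TensorProduct.map f LinearMap.id (comul (R := ℂ) a)))
    (a : C) : ∃ W : Submodule ℂ C, FiniteDimensional ℂ W ∧ a ∈ W ∧ ∀ x ∈ W, T x ∈ W := by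
  let E : (C →ₗ[ℂ] ℂ) → C →ₗ[ℂ] C := fun h =>
    (TensorProduct.lid ℂ C).toLinearMap ∘ₗ TensorProduct.map h LinearMap.id ∘ₗ comul (R := ℂ)
  have hE : ∀ h x, E h x
    = TensorProduct.lid ℂ C (TensorProduct.map h LinearMap.id (comul (R := ℂ) x)) :=
    fun _ _ => rfl
  let W : Submodule ℂ C := Submodule.span ℂ (Set.range fun h => E h a)
  refine ⟨W, ?_, ?_, ?_⟩
  · obtain ⟨s, l, r, hs⟩ : ∃ (s : Finset (C × C)) (l r : C × C → C),
        comul (R := ℂ) a = ∑ i ∈ s, l i ⊗ₜ[ℂ] r i := by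
      obtain ⟨s, hs⟩ := TensorProduct.exists_finset (comul (R := ℂ) a)
      exact ⟨s, Prod.fst, Prod.snd, hs⟩
    have : W ≤ Submodule.span ℂ (r '' (s : Set (C × C))) := by
      rw [Submodule.span_le]
      rintro _ ⟨h, rfl⟩
      simp only [hE, hs, map_sum, TensorProduct.map_tmul, TensorProduct.lid_tmul]
      exact Submodule.sum_mem _ fun i hi => Submodule.smul_mem _ _
        (Submodule.subset_span ⟨i, hi, rfl⟩)
    have : FiniteDimensional ℂ (Submodule.span ℂ (r '' (s : Set (C × C)))) :=
      FiniteDimensional.span_of_finite ℂ (s.finite_toSet.image r)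
    exact Submodule.finiteDimensional_of_le ‹W ≤ _›
  · refine Submodule.subset_span ⟨counit, ?_⟩
    have := rTensor_counit_comul (R := ℂ) a
    simp only [hE]
    rw [LinearMap.rTensor] at this
    rw [this]; simp
  · intro x hx
    induction hx using Submodule.span_induction with
    | mem x hx =>
      obtain ⟨h, rfl⟩ := hx
      refine Submodule.subset_span
        ⟨(TensorProduct.lid ℂ ℂ).toLinearMap ∘ₗ TensorProduct.map h f ∘ₗ comul (R := ℂ), ?_⟩
      let G : C ⊗[ℂ] (C ⊗[ℂ] C) →ₗ[ℂ] C := (TensorProduct.lid ℂ C).toLinearMap ∘ₗ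
        TensorProduct.map f LinearMap.id ∘ₗ (TensorProduct.lid ℂ _).toLinearMap ∘ₗ
        TensorProduct.map h LinearMap.id
      have e1 : ∀ z : C ⊗[ℂ] C, T (TensorProduct.lid ℂ C (TensorProduct.map h LinearMap.id z))
          = G (comul.lTensor C z) := by
        intro z
        induction z with
        | zero => simp
        | add x y hx hy => simp only [map_add, hx, hy]
        | tmul x y => simp [G, hT]
      have e3 : ∀ (w : C ⊗[ℂ] C) (y : C), G (TensorProduct.assoc ℂ C C C (w ⊗ₜ[ℂ] y))
          = (TensorProduct.lid ℂ ℂ (TensorProduct.map h f w)) • y := by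
        intro w y
        induction w with
        | zero => simp
        | add u v hu hv => simp only [map_add, TensorProduct.add_tmul, hu, hv, add_smul]
        | tmul u v => simp [G, mul_smul]
      have e2 : ∀ z : C ⊗[ℂ] C, G (TensorProduct.assoc ℂ C C C (comul.rTensor C z))
          = TensorProduct.lid ℂ C (TensorProduct.map ((TensorProduct.lid ℂ ℂ).toLinearMap ∘ₗ
            TensorProduct.map h f ∘ₗ comul (R := ℂ)) LinearMap.id z) := by
        intro z
        induction z with
        | zero => simp
        | add x y hx hy => simp only [map_add, hx, hy]
        | tmul x y => simp [e3]
      simp only [hE]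
      rw [e1, ← coassoc_apply, e2]
    | zero => simp
    | add x y _ _ hx hy => rw [map_add]; exact W.add_mem hx hy
    | smul c x _ hx => rw [map_smul]; exact W.smul_mem c hx

theorem aux_lf_right {C : Type*} [AddCommGroup C] [Module ℂ C] [Coalgebra ℂ C]
    (f : C →ₗ[ℂ] ℂ) (T : C →ₗ[ℂ] C)
    (hT : ∀ a, T a = TensorProduct.rid ℂ C (TensorProduct.map LinearMap.id f (comul (R := ℂ) a)))
    (a : C) : ∃ W : Submodule ℂ C, FiniteDimensional ℂ W ∧ a ∈ W ∧ ∀ x ∈ W, T x ∈ W := by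
  let E : (C →ₗ[ℂ] ℂ) → C →ₗ[ℂ] C := fun h =>
    (TensorProduct.rid ℂ C).toLinearMap ∘ₗ TensorProduct.map LinearMap.id h ∘ₗ comul (R := ℂ)
  have hE : ∀ h x, E h x
    = TensorProduct.rid ℂ C (TensorProduct.map LinearMap.id h (comul (R := ℂ) x)) :=
    fun _ _ => rfl
  let W : Submodule ℂ C := Submodule.span ℂ (Set.range fun h => E h a)
  refine ⟨W, ?_, ?_, ?_⟩
  · obtain ⟨s, l, r, hs⟩ : ∃ (s : Finset (C × C)) (l r : C × C → C),
        comul (R := ℂ) a = ∑ i ∈ s, l i ⊗ₜ[ℂ] r i := by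
      obtain ⟨s, hs⟩ := TensorProduct.exists_finset (comul (R := ℂ) a)
      exact ⟨s, Prod.fst, Prod.snd, hs⟩
    have : W ≤ Submodule.span ℂ (l '' (s : Set (C × C))) := by
      rw [Submodule.span_le]
      rintro _ ⟨h, rfl⟩
      simp only [hE, hs, map_sum, TensorProduct.map_tmul, TensorProduct.rid_tmul]
      exact Submodule.sum_mem _ fun i hi => Submodule.smul_mem _ _
        (Submodule.subset_span ⟨i, hi, rfl⟩)
    have : FiniteDimensional ℂ (Submodule.span ℂ (l '' (s : Set (C × C)))) :=
      FiniteDimensional.span_of_finite ℂ (s.finite_toSet.image l)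
    exact Submodule.finiteDimensional_of_le ‹W ≤ _›
  · refine Submodule.subset_span ⟨counit, ?_⟩
    have := lTensor_counit_comul (R := ℂ) a
    simp only [hE]
    rw [LinearMap.lTensor] at this
    rw [this]; simp
  · intro x hx
    induction hx using Submodule.span_induction with
    | mem x hx =>
      obtain ⟨h, rfl⟩ := hx
      refine Submodule.subset_span
        ⟨(TensorProduct.lid ℂ ℂ).toLinearMap ∘ₗ TensorProduct.map f h ∘ₗ comul (R := ℂ), ?_⟩
      let G : (C ⊗[ℂ] C) ⊗[ℂ] C →ₗ[ℂ] C := (TensorProduct.rid ℂ C).toLinearMap ∘ₗ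
        TensorProduct.map LinearMap.id f ∘ₗ (TensorProduct.rid ℂ _).toLinearMap ∘ₗ
        TensorProduct.map LinearMap.id h
      have e1 : ∀ z : C ⊗[ℂ] C, T (TensorProduct.rid ℂ C (TensorProduct.map LinearMap.id h z))
          = G (comul.rTensor C z) := by
        intro z
        induction z with
        | zero => simp
        | add x y hx hy => simp only [map_add, hx, hy]
        | tmul x y => simp [G, hT]
      have e3 : ∀ (w : C ⊗[ℂ] C) (y : C), G ((TensorProduct.assoc ℂ C C C).symm (y ⊗ₜ[ℂ] w))
          = (TensorProduct.lid ℂ ℂ (TensorProduct.map f h w)) • y := by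
        intro w y
        induction w with
        | zero => simp
        | add u v hu hv => simp only [map_add, TensorProduct.tmul_add, hu, hv, add_smul]
        | tmul u v => simp [G, mul_smul, smul_comm (f u)]
      have e2 : ∀ z : C ⊗[ℂ] C, G ((TensorProduct.assoc ℂ C C C).symm (comul.lTensor C z))
          = TensorProduct.rid ℂ C (TensorProduct.map LinearMap.id ((TensorProduct.lid ℂ ℂ).toLinearMap ∘ₗ
            TensorProduct.map f h ∘ₗ comul (R := ℂ)) z) := by
        intro z
        induction z with
        | zero => simp
        | add x y hx hy => simp only [map_add, hx, hy]
        | tmul x y => simp [e3]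
      simp only [hE]
      rw [e1, ← coassoc_symm_apply, e2]
    | zero => simp
    | add x y _ _ hx hy => rw [map_add]; exact W.add_mem hx hy
    | smul c x _ hx => rw [map_smul]; exact W.smul_mem c hx

theorem aux_pos {V : Type*} [AddCommGroup V] [Module ℂ V] (T : V →ₗ[ℂ] V)
    (hspan : Submodule.span ℂ {x : V | ∃ m : ℝ, 0 < m ∧ T x = (m : ℂ) • x} = ⊤)
    (z : V) (hz : z ≠ 0) (t : ℝ) (h : T z = (t : ℂ) • z) : 0 < t := by
  by_contra hn
  apply hz
  have hind := Module.End.eigenspaces_iSupIndep T (t : ℂ)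
  refine (Submodule.disjoint_def.1 hind) z (Module.End.mem_eigenspace_iff.2 h) ?_
  have hz' : z ∈ Submodule.span ℂ {x : V | ∃ m : ℝ, 0 < m ∧ T x = (m : ℂ) • x} := by
    rw [hspan]; trivial
  refine (Submodule.span_le.2 ?_) hz'
  rintro x ⟨m, hm, hx⟩
  have hne : (m : ℂ) ≠ (t : ℂ) := by
    intro e; rw [Complex.ofReal_inj.1 e] at hm; exact hn hm
  exact Submodule.mem_iSup_of_mem (m : ℂ) (Submodule.mem_iSup_of_mem hne
    (Module.End.mem_eigenspace_iff.2 hx))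

theorem aux_tensor {V : Type*} [AddCommGroup V] [Module ℂ V] (σ : V →ₗ[ℂ] V) (τ : V →ₗ[ℂ] V)
    (hσ : Submodule.span ℂ {x : V | ∃ m : ℝ, 0 < m ∧ σ x = (m : ℂ) • x} = ⊤)
    (hτ : Submodule.span ℂ {x : V | ∃ m : ℝ, 0 < m ∧ τ x = (m : ℂ) • x} = ⊤) :
    Submodule.span ℂ {z : V ⊗[ℂ] V | ∃ m : ℝ, 0 < m ∧ TensorProduct.map σ τ z = (m : ℂ) • z}
      = ⊤ := by
  rw [eq_top_iff, ← TensorProduct.span_tmul_eq_top, Submodule.span_le]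
  rintro _ ⟨x, y, rfl⟩
  have hx : x ∈ Submodule.span ℂ {x : V | ∃ m : ℝ, 0 < m ∧ σ x = (m : ℂ) • x} := by
    rw [hσ]; trivial
  have hy : y ∈ Submodule.span ℂ {x : V | ∃ m : ℝ, 0 < m ∧ τ x = (m : ℂ) • x} := by
    rw [hτ]; trivial
  rw [SetLike.mem_coe]
  induction hx using Submodule.span_induction with
  | zero => simp
  | add u v _ _ hu hv => rw [TensorProduct.add_tmul]; exact Submodule.add_mem _ hu hv
  | smul c u _ hu => rw [← TensorProduct.smul_tmul']; exact Submodule.smul_mem _ _ hu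
  | mem x hx =>
    induction hy using Submodule.span_induction with
    | zero => simp
    | add u v _ _ hu hv => rw [TensorProduct.tmul_add]; exact Submodule.add_mem _ hu hv
    | smul c u _ hu => rw [TensorProduct.tmul_smul]; exact Submodule.smul_mem _ _ hu
    | mem y hy =>
      obtain ⟨m, hm, hx⟩ := hx
      obtain ⟨n, hn, hy⟩ := hy
      refine Submodule.subset_span ⟨m * n, mul_pos hm hn, ?_⟩
      rw [TensorProduct.map_tmul, hx, hy, TensorProduct.smul_tmul_smul, Complex.ofReal_mul]

/-- A `*`-algebraic quantum group `A` (here: a Hopf `*`-algebra over `ℂ` with a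
faithful positive right integral `ψ`, modular automorphisms `σ'` and `σ`, and modular element `δ`)
is spanned by common eigenvectors, with strictly positive eigenvalues, of the three maps
`S²`, `σ` and `σ'`. -/
theorem algebraic_quantum_group_spanned_by_common_eigenvectors
    {A : Type*} [Ring A] [HopfAlgebra ℂ A] [StarRing A] [StarModule ℂ A]
    -- compatibility of the comultiplication with the star structure:
    -- `st` is the (well-defined) conjugate-linear map `p ⊗ q ↦ star p ⊗ star q`
    (st : A ⊗[ℂ] A → A ⊗[ℂ] A)
    (hst_add : ∀ z w : A ⊗[ℂ] A, st (z + w) = st z + st w)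
    (hst_smul : ∀ (c : ℂ) (z : A ⊗[ℂ] A), st (c • z) = (starRingEnd ℂ c) • st z)
    (hst_tmul : ∀ p q : A, st (p ⊗ₜ[ℂ] q) = (star p) ⊗ₜ[ℂ] (star q))
    (hcomul_star : ∀ a : A, comul (R := ℂ) (star a) = st (comul (R := ℂ) a))
    -- the antipode is bijective: `Se` is `S` as a linear equivalence
    (Se : A ≃ₗ[ℂ] A) (hSe : ∀ a : A, Se a = antipode (R := ℂ) a)
    (hstar_S : ∀ a : A, star (antipode (R := ℂ) a) = Se.symm (star a))
    -- `ψ` is a faithful positive right integral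
    (ψ : A →ₗ[ℂ] ℂ)
    (hψ_inv : ∀ a : A,
      (TensorProduct.lid ℂ A) ((TensorProduct.map ψ LinearMap.id) (comul (R := ℂ) a))
        = ψ a • (1 : A))
    (hψ_pos : ∀ a : A, 0 ≤ ψ (star a * a))
    (hψ_faithful : ∀ a : A, ψ (star a * a) = 0 → a = 0)
    -- `σ'` is the modular automorphism of `ψ`
    (σ' : A ≃ₐ[ℂ] A)
    (hσ' : ∀ a b : A, ψ (a * b) = ψ (b * σ' a))
    -- `φ := ψ ∘ S` is a positive left integral, with modular automorphism `σ`
    (hφ_inv : ∀ a : A,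
      (TensorProduct.rid ℂ A)
          ((TensorProduct.map LinearMap.id (ψ ∘ₗ antipode (R := ℂ))) (comul (R := ℂ) a))
        = ψ (antipode (R := ℂ) a) • (1 : A))
    (hφ_pos : ∀ a : A, 0 ≤ ψ (antipode (R := ℂ) (star a * a)))
    (σ : A ≃ₐ[ℂ] A)
    (hσ : ∀ a b : A, ψ (antipode (R := ℂ) (a * b)) = ψ (antipode (R := ℂ) (b * σ a)))
    -- `δ` is the modular element
    (δ : Aˣ)
    (hδ_comul : comul (R := ℂ) (δ : A) = (δ : A) ⊗ₜ[ℂ] (δ : A))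
    (hδ_S : antipode (R := ℂ) (δ : A) = ((δ⁻¹ : Aˣ) : A))
    (hδ_star : star (δ : A) = (δ : A))
    (hδ_σ : σ (δ : A) = (δ : A))
    (hδ_σ' : σ' (δ : A) = (δ : A))
    (hψS : ∀ a : A, ψ (antipode (R := ℂ) a) = ψ (a * ((δ⁻¹ : Aˣ) : A)))
    (hψφ : ∀ a : A, ψ a = ψ (antipode (R := ℂ) (a * (δ : A))))
    -- a self-adjoint square root of `δ`
    (d : A) (hd_star : star d = d) (hd_sq : d * d = (δ : A))
    -- the standard commutation relations
    (hcomm_σσ' : ∀ a : A, σ (σ' a) = σ' (σ a))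
    (hcomm_S2σ : ∀ a : A,
      σ (antipode (R := ℂ) (antipode (R := ℂ) a))
        = antipode (R := ℂ) (antipode (R := ℂ) (σ a)))
    (hcomm_S2σ' : ∀ a : A,
      σ' (antipode (R := ℂ) (antipode (R := ℂ) a))
        = antipode (R := ℂ) (antipode (R := ℂ) (σ' a)))
    (hΔS2 : ∀ a : A,
      comul (R := ℂ) (antipode (R := ℂ) (antipode (R := ℂ) a))
        = (TensorProduct.map σ.toLinearMap σ'.symm.toLinearMap) (comul (R := ℂ) a))
    (hσσ'δ : ∀ a : A, σ (σ' a) = (δ : A) * σ (σ a) * ((δ⁻¹ : Aˣ) : A)) :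
    Submodule.span ℂ {a : A | ∃ lam mu nu : ℝ, 0 < lam ∧ 0 < mu ∧ 0 < nu ∧
        antipode (R := ℂ) (antipode (R := ℂ) a) = (lam : ℂ) • a ∧
        σ a = (mu : ℂ) • a ∧ σ' a = (nu : ℂ) • a} = ⊤ := by
  have hS_mul : ∀ a b : A, antipode ℂ (antipode ℂ (a * b))
      = antipode ℂ (antipode ℂ a) * antipode ℂ (antipode ℂ b) := by
    intro a b
    rw [antipode_mul_antidistrib, antipode_mul_antidistrib]
  have hne : (1 : A) ≠ 0 := by
    intro h
    have := congrArg (counit (R := ℂ)) h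
    simp at this
  have hψ1 : ψ 1 ≠ 0 := by
    intro h
    exact hne (hψ_faithful 1 (by simpa using h))
  -- unimodularity
  have hψ_S : ∀ a, ψ (antipode ℂ a) = ψ a := by
    intro a
    have k : ∀ z : A ⊗[ℂ] A,
        ψ (antipode ℂ (TensorProduct.lid ℂ A (TensorProduct.map ψ LinearMap.id z)))
          = ψ (TensorProduct.rid ℂ A
            (TensorProduct.map LinearMap.id (ψ ∘ₗ antipode (R := ℂ)) z)) := by
      intro z
      induction z with
      | zero => simp
      | add x y hx hy => simp only [map_add, hx, hy]
      | tmul x y => simp [mul_comm]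
    have := k (comul (R := ℂ) a)
    rw [hψ_inv, hφ_inv, map_smul, map_smul, map_smul, antipode_one, smul_eq_mul,
      smul_eq_mul] at this
    exact (mul_right_cancel₀ hψ1 this).symm
  have hzero : ∀ x, (∀ b, ψ (b * x) = 0) → x = 0 := fun x h => hψ_faithful x (h _)
  have hσ2 : ∀ a b, ψ (a * b) = ψ (b * σ a) := by
    intro a b
    have := hσ a b
    rwa [hψ_S, hψ_S] at this
  have hσeq : ∀ a, σ' a = σ a := by
    intro a
    refine sub_eq_zero.1 (hzero _ fun b => ?_)
    rw [mul_sub, map_sub, ← hσ', ← hσ2, sub_self]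
  have hσeq' : σ' = σ := AlgEquiv.ext hσeq
  subst hσeq'
  -- the inner product
  have him : ∀ a, (ψ (star a * a)).im = 0 := fun a => ((Complex.le_def.1 (hψ_pos a)).2).symm
  have hherm : ∀ x y : A, (starRingEnd ℂ) (ψ (star y * x)) = ψ (star x * y) := by
    intro x y
    have h1 := him (x + y)
    have h2 := him (x + Complex.I • y)
    have hx := him x
    have hy := him y
    simp only [star_add, star_smul, add_mul, mul_add, map_add, smul_mul_assoc, mul_smul_comm,
      map_smul, smul_eq_mul, Complex.add_im, Complex.mul_im, Complex.mul_re, Complex.I_re,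
      Complex.I_im, Complex.star_def, Complex.conj_I, Complex.neg_im, Complex.neg_re] at h1 h2
    apply Complex.ext
    · rw [Complex.conj_re]; linarith
    · rw [Complex.conj_im]; linarith
  let c : InnerProductSpace.Core ℂ A :=
    { inner := fun x y => ψ (star x * y)
      conj_inner_symm := fun x y => hherm x y
      re_inner_nonneg := fun x => (Complex.le_def.1 (hψ_pos x)).1
      add_left := fun x y z => by simp [add_mul]
      smul_left := fun x y r => by simp
      definite := fun x h => hψ_faithful x h }
  have hsym_σ : ∀ x y, ψ (star (σ' x) * y) = ψ (star x * σ' y) := by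
    intro x y
    rw [← hherm, ← hσ2]
    have := hherm (star y) (star x)
    rw [star_star, star_star] at this
    rw [this, hσ2]
  have hsym_σi : ∀ x y, ψ (star (σ'.symm x) * y) = ψ (star x * σ'.symm y) := by
    intro x y
    have := hsym_σ (σ'.symm x) (σ'.symm y)
    rw [AlgEquiv.apply_symm_apply, AlgEquiv.apply_symm_apply] at this
    exact this.symm
  have hsym_S : ∀ x y, ψ (star (antipode ℂ (antipode ℂ x)) * y)
      = ψ (star x * antipode ℂ (antipode ℂ y)) := by
    intro x y
    rw [hstar_S, hstar_S, ← hψ_S, ← hψ_S (antipode ℂ _), hS_mul, ← hSe (Se.symm _),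
      LinearEquiv.apply_symm_apply, ← hSe (Se.symm _), LinearEquiv.apply_symm_apply]
  have hcommi : ∀ a, σ'.symm (antipode ℂ (antipode ℂ a))
      = antipode ℂ (antipode ℂ (σ'.symm a)) := by
    intro a
    rw [AlgEquiv.symm_apply_eq, hcomm_S2σ', AlgEquiv.apply_symm_apply]
  let S2 : A →ₗ[ℂ] A := antipode ℂ ∘ₗ antipode ℂ
  have hS2 : ∀ a, S2 a = antipode ℂ (antipode ℂ a) := fun _ => rfl
  have hS2inj : ∀ a, S2 a = 0 → a = 0 := by
    intro a h
    rw [hS2, ← hSe, ← hSe] at h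
    simpa using h
  let T1 : A →ₗ[ℂ] A := σ'.toLinearMap ∘ₗ S2
  let T2 : A →ₗ[ℂ] A := σ'.symm.toLinearMap ∘ₗ S2
  have hT1 : ∀ a, T1 a = σ' (antipode ℂ (antipode ℂ a)) := fun _ => rfl
  have hT2 : ∀ a, T2 a = σ'.symm (antipode ℂ (antipode ℂ a)) := fun _ => rfl
  have hT1s : ∀ x y, c.inner (T1 x) y = c.inner x (T1 y) := by
    intro x y
    change ψ (star (T1 x) * y) = ψ (star x * T1 y)
    rw [hT1, hT1, hsym_σ, hsym_S, hcomm_S2σ']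
  have hT2s : ∀ x y, c.inner (T2 x) y = c.inner x (T2 y) := by
    intro x y
    change ψ (star (T2 x) * y) = ψ (star x * T2 y)
    rw [hT2, hT2, hsym_σi, hsym_S, hcommi]
  have hT12 : ∀ a, T1 (T2 a) = T2 (T1 a) := by
    intro a
    rw [hT1, hT2, hT2, hT1, ← hcommi, AlgEquiv.apply_symm_apply, ← hcomm_S2σ',
      AlgEquiv.symm_apply_apply]
  have hl : ∀ a, T1 a = TensorProduct.lid ℂ A
      (TensorProduct.map (counit ∘ₗ σ'.toLinearMap) LinearMap.id (comul (R := ℂ) a)) := by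
    intro a
    have e : ∀ z : A ⊗[ℂ] A, σ' (TensorProduct.lid ℂ A (counit.rTensor A
        (TensorProduct.map σ'.toLinearMap σ'.symm.toLinearMap z)))
        = TensorProduct.lid ℂ A
          (TensorProduct.map (counit ∘ₗ σ'.toLinearMap) LinearMap.id z) := by
      intro z
      induction z with
      | zero => simp
      | add x y hx hy => simp only [map_add, hx, hy]
      | tmul x y => simp
    rw [← e, ← hΔS2, rTensor_counit_comul, TensorProduct.lid_tmul, one_smul, hT1]
  have hr : ∀ a, T2 a = TensorProduct.rid ℂ A
      (TensorProduct.map LinearMap.id (counit ∘ₗ σ'.symm.toLinearMap) (comul (R := ℂ) a)) := by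
    intro a
    have e : ∀ z : A ⊗[ℂ] A, σ'.symm (TensorProduct.rid ℂ A (counit.lTensor A
        (TensorProduct.map σ'.toLinearMap σ'.symm.toLinearMap z)))
        = TensorProduct.rid ℂ A
          (TensorProduct.map LinearMap.id (counit ∘ₗ σ'.symm.toLinearMap) z) := by
      intro z
      induction z with
      | zero => simp
      | add x y hx hy => simp only [map_add, hx, hy]
      | tmul x y => simp
    rw [← e, ← hΔS2, lTensor_counit_comul, TensorProduct.rid_tmul, one_smul, hT2]
  have hkey : ∀ (y : A) (t s : ℝ), T1 y = (t : ℂ) • y → T2 y = (s : ℂ) • y →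
      ∃ m l : ℝ, 0 < m ∧ σ' y = (m : ℂ) • y ∧ S2 y = (l : ℂ) • y := by
    intro y t s ht hs
    by_cases hy : y = 0
    · exact ⟨1, 1, one_pos, by simp [hy], by simp [hy]⟩
    have h1 : S2 y = (s : ℂ) • σ' y := by
      have := congrArg σ' hs
      rwa [hT2, AlgEquiv.apply_symm_apply, map_smul] at this
    have hs0 : (s : ℂ) ≠ 0 := by
      intro h
      rw [h, zero_smul] at h1
      exact hy (hS2inj y h1)
    have h2 : σ' (σ' y) = ((t / s : ℝ) : ℂ) • y := by
      rw [hT1, ← hS2, h1, map_smul] at ht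
      rw [Complex.ofReal_div, div_eq_inv_mul, mul_smul, ← ht, smul_smul, inv_mul_cancel₀ hs0,
        one_smul]
    generalize t / s = r at h2
    have hp0 : (ψ (star y * y)).re ≠ 0 := by
      intro h
      exact hy (hψ_faithful y (Complex.ext h (him y)))
    have hp : 0 < (ψ (star y * y)).re :=
      lt_of_le_of_ne (Complex.le_def.1 (hψ_pos y)).1 (Ne.symm hp0)
    have hr0 : r ≠ 0 := by
      intro h
      rw [h, Complex.ofReal_zero, zero_smul] at h2
      exact hy (by simpa using h2)
    have hr1 : 0 ≤ r := by
      have h3 := (Complex.le_def.1 (hψ_pos (σ' y))).1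
      rw [hsym_σ, h2, mul_smul_comm, map_smul, smul_eq_mul, Complex.re_ofReal_mul] at h3
      exact nonneg_of_mul_nonneg_left h3 hp
    have hrpos : 0 < r := lt_of_le_of_ne hr1 (Ne.symm hr0)
    have hq : 0 < √r := Real.sqrt_pos.2 hrpos
    have hqq : ((√r : ℝ) : ℂ) * ((√r : ℝ) : ℂ) = (r : ℂ) := by
      rw [← Complex.ofReal_mul, Real.mul_self_sqrt hr1]
    have hu : σ' y - ((√r : ℝ) : ℂ) • y = 0 := by
      have hu1 : σ' (σ' y - ((√r : ℝ) : ℂ) • y)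
          = ((-√r : ℝ) : ℂ) • (σ' y - ((√r : ℝ) : ℂ) • y) := by
        rw [map_sub, map_smul, h2, ← hqq, Complex.ofReal_neg]
        module
      generalize σ' y - ((√r : ℝ) : ℂ) • y = u at hu1
      have h3 := (Complex.le_def.1 (hψ_pos (star u))).1
      rw [star_star, hσ2, hu1, mul_smul_comm, map_smul, smul_eq_mul,
        Complex.re_ofReal_mul] at h3
      have h4 := (Complex.le_def.1 (hψ_pos u)).1
      rw [Complex.zero_re] at h3 h4
      refine hψ_faithful u (Complex.ext ?_ (him u))
      rw [Complex.zero_re]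
      nlinarith
    have hu' := sub_eq_zero.1 hu
    refine ⟨√r, s * √r, hq, hu', ?_⟩
    rw [h1, hu', smul_smul, Complex.ofReal_mul]
  have hspan : Submodule.span ℂ {y : A | ∃ m l : ℝ, 0 < m ∧ σ' y = (m : ℂ) • y ∧
      S2 y = (l : ℂ) • y} = ⊤ := by
    rw [eq_top_iff]
    intro a _
    obtain ⟨W, hWf, haW, hWT⟩ := aux_lf_left _ T1 hl a
    refine (Submodule.span_le.2 ?_) (aux_diag c T1 hT1s W hWf hWT a haW)
    rintro x ⟨_, t, hxt⟩
    obtain ⟨W', hWf', hxW', hWT'⟩ := aux_lf_right _ T2 hr x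
    have hfd : FiniteDimensional ℂ (W' ⊓ Module.End.eigenspace T1 (t : ℂ) : Submodule ℂ A) :=
      Submodule.finiteDimensional_of_le inf_le_left
    refine (Submodule.span_le.2 ?_) (aux_diag c T2 hT2s
      (W' ⊓ Module.End.eigenspace T1 (t : ℂ)) hfd ?_ x
      ⟨hxW', Module.End.mem_eigenspace_iff.2 hxt⟩)
    · rintro y ⟨⟨_, hy⟩, s, hys⟩
      exact Submodule.subset_span (hkey y t s (Module.End.mem_eigenspace_iff.1 hy) hys)
    · rintro y ⟨hy1, hy2⟩
      refine ⟨hWT' y hy1, Module.End.mem_eigenspace_iff.2 ?_⟩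
      rw [hT12, Module.End.mem_eigenspace_iff.1 hy2, map_smul]
  have hsp1 : Submodule.span ℂ {x : A | ∃ m : ℝ, 0 < m ∧ σ'.toLinearMap x = (m : ℂ) • x}
      = ⊤ := by
    rw [eq_top_iff, ← hspan]
    refine Submodule.span_mono ?_
    rintro y ⟨m, l, hm, h, _⟩
    exact ⟨m, hm, h⟩
  have hsp2 : Submodule.span ℂ {x : A | ∃ m : ℝ, 0 < m ∧ σ'.symm.toLinearMap x = (m : ℂ) • x}
      = ⊤ := by
    rw [eq_top_iff, ← hspan]
    refine Submodule.span_mono ?_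
    rintro y ⟨m, l, hm, h, _⟩
    refine ⟨m⁻¹, inv_pos.2 hm, ?_⟩
    have hm0 : (m : ℂ) ≠ 0 := Complex.ofReal_ne_zero.2 hm.ne'
    rw [AlgEquiv.toLinearMap_apply, AlgEquiv.symm_apply_eq, map_smul, h, smul_smul,
      Complex.ofReal_inv, inv_mul_cancel₀ hm0, one_smul]
  rw [eq_top_iff, ← hspan]
  refine Submodule.span_le.2 ?_
  rintro y ⟨m, l, hm, h, hl'⟩
  by_cases hy : y = 0
  · rw [hy]; exact Submodule.zero_mem _
  refine Submodule.subset_span ⟨l, m, m, ?_, hm, hm, hl', h, h⟩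
  refine aux_pos _ (aux_tensor _ _ hsp1 hsp2) (comul (R := ℂ) y) ?_ l ?_
  · intro h0
    have := rTensor_counit_comul (R := ℂ) y
    rw [h0, map_zero] at this
    have := congrArg (TensorProduct.lid ℂ A) this
    rw [map_zero, TensorProduct.lid_tmul, one_smul] at this
    exact hy this.symm
  · rw [← hΔS2, ← hS2, hl', map_smul]
end

section
/- For every a ∈ A, the value ψ((star a) * S(S a)) is a nonnegative real number. -/
open TensorProduct HopfAlgebra Coalgebra ComplexOrder

/-- If `ψ` is a positive right integral on a Hopf `*`-algebra `A` over `ℂ`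
such that `φ := ψ ∘ S` is also positive, then `ψ((star a) * S(S(a)))` is a nonnegative real
number for every `a ∈ A`. -/
theorem psi_star_mul_antipode_sq_nonneg
    {A : Type*} [Ring A] [HopfAlgebra ℂ A] [StarRing A] [StarModule ℂ A]
    -- compatibility of the comultiplication with the star structure:
    (st : A ⊗[ℂ] A → A ⊗[ℂ] A)
    (hst_add : ∀ z w : A ⊗[ℂ] A, st (z + w) = st z + st w)
    (hst_smul : ∀ (c : ℂ) (z : A ⊗[ℂ] A), st (c • z) = (starRingEnd ℂ c) • st z)
    (hst_tmul : ∀ p q : A, st (p ⊗ₜ[ℂ] q) = (star p) ⊗ₜ[ℂ] (star q))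
    (hcomul_star : ∀ a : A, comul (R := ℂ) (star a) = st (comul (R := ℂ) a))
    -- the antipode is bijective: `Se` is `S` as a linear equivalence
    (Se : A ≃ₗ[ℂ] A) (hSe : ∀ a : A, Se a = antipode (R := ℂ) a)
    (hstar_S : ∀ a : A, star (antipode (R := ℂ) a) = Se.symm (star a))
    -- `ψ` is a positive right integral
    (ψ : A →ₗ[ℂ] ℂ)
    (hψ_inv : ∀ a : A,
      (TensorProduct.lid ℂ A) ((TensorProduct.map ψ LinearMap.id) (comul (R := ℂ) a))
        = ψ a • (1 : A))
    (hψ_pos : ∀ a : A, 0 ≤ ψ (star a * a))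
    -- `φ := ψ ∘ S` is also positive
    (hφ_pos : ∀ a : A, 0 ≤ ψ (antipode (R := ℂ) (star a * a)))
    (a : A) :
    0 ≤ ψ (star a * antipode (R := ℂ) (antipode (R := ℂ) a)) := by
  have h := hφ_pos (star (antipode ℂ a))
  rw [star_star, hstar_S, antipode_mul_antidistrib, ← hSe (Se.symm (star a)),
    LinearEquiv.apply_symm_apply] at h
  exact h
end

section
/- For every a ∈ A, the value ψ((star a) * σ(a)) is a nonnegative real number. -/
open TensorProduct HopfAlgebra Coalgebra ComplexOrder

/-- Let `A` be a Hopf `*`-algebra over `ℂ`, `ψ` a linear functional such that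
`φ := ψ ∘ S` is positive, `σ` the modular automorphism of `φ`, and `δ` the modular element
(self-adjoint, `σ`-invariant, with `ψ(a) = φ(a * δ)`, admitting a self-adjoint square root `d`).
Then `ψ((star a) * σ(a))` is a nonnegative real number for every `a ∈ A`. -/
theorem psi_star_mul_sigma_nonneg
    {A : Type*} [Ring A] [HopfAlgebra ℂ A] [StarRing A] [StarModule ℂ A]
    (ψ : A →ₗ[ℂ] ℂ)
    -- `φ := ψ ∘ S` is positive
    (hφ_pos : ∀ a : A, 0 ≤ ψ (antipode (R := ℂ) (star a * a)))
    -- `σ` is the modular automorphism of `φ`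
    (σ : A ≃ₐ[ℂ] A)
    (hσ : ∀ a b : A, ψ (antipode (R := ℂ) (a * b)) = ψ (antipode (R := ℂ) (b * σ a)))
    -- `δ` is the modular element
    (δ : Aˣ)
    (hδ_star : star (δ : A) = (δ : A))
    (hδ_σ : σ (δ : A) = (δ : A))
    (hψφ : ∀ a : A, ψ a = ψ (antipode (R := ℂ) (a * (δ : A))))
    -- a self-adjoint square root of `δ`
    (d : A) (hd_star : star d = d) (hd_sq : d * d = (δ : A))
    (a : A) :
    0 ≤ ψ (star a * σ a) := by
  have h := hφ_pos (d * star a)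
  have e1 : star a * σ a * (δ : A) = star a * σ (a * (δ : A)) := by
    rw [map_mul, hδ_σ, mul_assoc]
  have e2 : a * (δ : A) * star a = star (d * star a) * (d * star a) := by
    rw [star_mul, star_star, hd_star, ← hd_sq]
    simp only [mul_assoc]
  rw [hψφ, e1, ← hσ, e2]
  exact h
end

section
/- For every a ∈ A there exists a finite-dimensional ℂ-subspace L of A containing Sⁿ(a), σⁿ(a) and σ'ⁿ(a) for every integer n (positive and negative iterates of the bijections S, σ and σ'). -/
open TensorProduct HopfAlgebra Coalgebra ComplexOrder

section Aux
open WithConv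

variable {A : Type*} [Ring A] [HopfAlgebra ℂ A]

lemma aux_comul_antipode (a : A) :
    comul (R := ℂ) (antipode ℂ a) =
      TensorProduct.map (antipode ℂ) (antipode ℂ) (TensorProduct.comm ℂ A A (comul (R := ℂ) a)) := by
  let i1 : A →ₐ[ℂ] A ⊗[ℂ] A := Algebra.TensorProduct.includeLeft
  let i2 : A →ₐ[ℂ] A ⊗[ℂ] A := Algebra.TensorProduct.includeRight
  have key : ∀ i : A →ₐ[ℂ] A ⊗[ℂ] A,
      toConv (i.toLinearMap ∘ₗ antipode ℂ) * toConv i.toLinearMap = 1 := by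
    intro i
    have h := LinearMap.algHom_comp_convMul_distrib i (toConv (antipode ℂ (A := A)))
      (toConv LinearMap.id)
    rw [LinearMap.antipode_mul_id] at h
    apply WithConv.ofConv_injective
    simp only [LinearMap.comp_id, ofConv_toConv] at h
    rw [← h]
    ext x
    simp
  have hδ : toConv (comul (R := ℂ) (A := A)) = toConv i1.toLinearMap * toConv i2.toLinearMap := by
    ext x
    rw [(ℛ ℂ x).convMul_apply]
    simp [i1, i2, (ℛ ℂ x).eq]
  have hG : toConv (TensorProduct.map (antipode ℂ) (antipode ℂ) ∘ₗ
      (TensorProduct.comm ℂ A A).toLinearMap ∘ₗ comul (R := ℂ) (A := A)) =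
      toConv (i2.toLinearMap ∘ₗ antipode ℂ) * toConv (i1.toLinearMap ∘ₗ antipode ℂ) := by
    ext x
    rw [(ℛ ℂ x).convMul_apply]
    conv_lhs => simp only [LinearMap.comp_apply, ← (ℛ ℂ x).eq]
    simp [i1, i2, ← (ℛ ℂ x).eq]
  have h1 : toConv (TensorProduct.map (antipode ℂ) (antipode ℂ) ∘ₗ
      (TensorProduct.comm ℂ A A).toLinearMap ∘ₗ comul (R := ℂ) (A := A)) *
      toConv (comul (R := ℂ) (A := A)) = 1 := by
    rw [hG, hδ, mul_assoc, ← mul_assoc (toConv (i1.toLinearMap ∘ₗ antipode ℂ)), key, one_mul, key]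
  have h2 := left_inv_eq_right_inv h1 (LinearMap.comul_right_inv (R := ℂ) (C := A))
  have h3 := WithConv.toConv_injective h2
  exact (LinearMap.congr_fun h3 a).symm

lemma aux_comul_S2 (a : A) :
    comul (R := ℂ) (antipode ℂ (antipode ℂ a)) =
      TensorProduct.map (antipode ℂ ∘ₗ antipode ℂ) (antipode ℂ ∘ₗ antipode ℂ)
        (comul (R := ℂ) a) := by
  rw [aux_comul_antipode, aux_comul_antipode]
  conv_lhs => simp only [← (ℛ ℂ a).eq]
  conv_rhs => simp only [← (ℛ ℂ a).eq]
  simp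

end Aux

section LF
variable {V : Type*} [AddCommGroup V] [Module ℂ V]

def AuxLF (f : V ≃ₗ[ℂ] V) : Prop :=
  ∀ a : V, ∃ L : Submodule ℂ V, FiniteDimensional ℂ L ∧ ∀ n : ℤ, (f ^ n) a ∈ L

lemma AuxLF.inv {f : V ≃ₗ[ℂ] V} (h : AuxLF f) : AuxLF f⁻¹ := by
  intro a
  obtain ⟨L, hL, hn⟩ := h a
  exact ⟨L, hL, fun n => by simpa [inv_zpow'] using hn (-n)⟩

lemma AuxLF.mul {f g : V ≃ₗ[ℂ] V} (hf : AuxLF f) (hg : AuxLF g) (hc : Commute f g) :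
    AuxLF (f * g) := by
  intro a
  obtain ⟨L, hL, hn⟩ := hg a
  choose M hM hMn using hf
  obtain ⟨s, hs⟩ := (Submodule.fg_iff_finiteDimensional L).2 hL
  refine ⟨⨆ x ∈ s, M x, ?_, ?_⟩
  · exact Submodule.finiteDimensional_finset_sup s M |> fun h => by
      rwa [Finset.sup_eq_iSup] at h
  · intro n
    rw [hc.mul_zpow]
    have h1 : L ≤ (⨆ x ∈ s, M x).comap ((f ^ n : V ≃ₗ[ℂ] V) : V →ₗ[ℂ] V) := by
      rw [← hs, Submodule.span_le]
      intro x hx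
      exact (le_iSup₂_of_le (f := fun x (_ : x ∈ s) => M x) x hx le_rfl) (hMn x n)
    exact h1 (hn n)

lemma AuxLF.of_sq {f : V ≃ₗ[ℂ] V} (h : AuxLF (f * f)) : AuxLF f := by
  intro a
  obtain ⟨L, hL, hn⟩ := h a
  refine ⟨L ⊔ L.map (f : V →ₗ[ℂ] V), inferInstance, fun n => ?_⟩
  rcases Int.even_or_odd' n with ⟨k, rfl | rfl⟩
  · refine Submodule.mem_sup_left ?_
    rw [zpow_mul, zpow_two]
    exact hn k
  · refine Submodule.mem_sup_right ⟨_, hn k, ?_⟩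
    rw [add_comm, zpow_one_add, zpow_mul, zpow_two]
    rfl

end LF

section Inv
variable {A : Type*} [Ring A] [HopfAlgebra ℂ A]

lemma aux_pow (f g : A ≃ₗ[ℂ] A)
    (h : ∀ a : A, TensorProduct.map (f : A →ₗ[ℂ] A) (g : A →ₗ[ℂ] A) (comul (R := ℂ) a) =
      comul (R := ℂ) a) (n : ℤ) (a : A) :
    TensorProduct.map ((f ^ n : A ≃ₗ[ℂ] A) : A →ₗ[ℂ] A) ((g ^ n : A ≃ₗ[ℂ] A) : A →ₗ[ℂ] A)
      (comul (R := ℂ) a) = comul (R := ℂ) a := by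
  have mm : ∀ (p q r s : A ≃ₗ[ℂ] A) (z : A ⊗[ℂ] A),
      TensorProduct.map ((p * q : A ≃ₗ[ℂ] A) : A →ₗ[ℂ] A) ((r * s : A ≃ₗ[ℂ] A) : A →ₗ[ℂ] A) z =
      TensorProduct.map (p : A →ₗ[ℂ] A) (r : A →ₗ[ℂ] A)
        (TensorProduct.map (q : A →ₗ[ℂ] A) (s : A →ₗ[ℂ] A) z) := by
    intro p q r s z
    induction z with
    | zero => simp
    | tmul x y => simp
    | add x y hx hy => simp only [map_add, hx, hy]
  have m1 : ∀ z : A ⊗[ℂ] A, TensorProduct.map ((1 : A ≃ₗ[ℂ] A) : A →ₗ[ℂ] A)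
      ((1 : A ≃ₗ[ℂ] A) : A →ₗ[ℂ] A) z = z := by
    intro z
    induction z with
    | zero => simp
    | tmul x y => simp
    | add x y hx hy => simp only [map_add, hx, hy]
  have hinv : TensorProduct.map ((f⁻¹ : A ≃ₗ[ℂ] A) : A →ₗ[ℂ] A)
      ((g⁻¹ : A ≃ₗ[ℂ] A) : A →ₗ[ℂ] A) (comul (R := ℂ) a) = comul (R := ℂ) a := by
    conv_lhs => rw [← h a, ← mm, inv_mul_cancel, inv_mul_cancel, m1]
  induction n with
  | zero => rw [zpow_zero, zpow_zero, m1]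
  | succ n ih => rw [zpow_add_one, zpow_add_one, mm, h, ih]
  | pred n ih => rw [zpow_sub_one, zpow_sub_one, mm, hinv, ih]

lemma aux_LF_right (f g : A ≃ₗ[ℂ] A)
    (h : ∀ a : A, TensorProduct.map (f : A →ₗ[ℂ] A) (g : A →ₗ[ℂ] A) (comul (R := ℂ) a) =
      comul (R := ℂ) a) : AuxLF g := by
  intro a
  refine ⟨Submodule.span ℂ ((ℛ ℂ a).right '' ((ℛ ℂ a).index : Set _)),
    FiniteDimensional.span_of_finite ℂ ((Finset.finite_toSet _).image _), fun n => ?_⟩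
  have h1 := aux_pow f g h (-n) a
  have h2 := congrArg (fun z => (g ^ n) (TensorProduct.lid ℂ A
    ((counit (R := ℂ) (A := A)).rTensor A z))) h1
  simp only [rTensor_counit_comul, lid_tmul, one_smul] at h2
  rw [← h2, ← (ℛ ℂ a).eq]
  simp only [map_sum, TensorProduct.map_tmul, LinearMap.rTensor_tmul, lid_tmul, map_smul]
  refine Submodule.sum_mem _ fun i hi => Submodule.smul_mem _ _ ?_
  have : (g ^ n) ((g ^ (-n)) ((ℛ ℂ a).right i)) = (ℛ ℂ a).right i := by
    rw [← LinearEquiv.mul_apply, ← zpow_add]; simp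
  simp only [LinearEquiv.coe_coe, this]
  exact Submodule.subset_span ⟨i, hi, rfl⟩

lemma aux_LF_left (f g : A ≃ₗ[ℂ] A)
    (h : ∀ a : A, TensorProduct.map (f : A →ₗ[ℂ] A) (g : A →ₗ[ℂ] A) (comul (R := ℂ) a) =
      comul (R := ℂ) a) : AuxLF f := by
  intro a
  refine ⟨Submodule.span ℂ ((ℛ ℂ a).left '' ((ℛ ℂ a).index : Set _)),
    FiniteDimensional.span_of_finite ℂ ((Finset.finite_toSet _).image _), fun n => ?_⟩
  have h1 := aux_pow f g h (-n) a
  have h2 := congrArg (fun z => (f ^ n) (TensorProduct.rid ℂ A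
    ((counit (R := ℂ) (A := A)).lTensor A z))) h1
  simp only [lTensor_counit_comul, rid_tmul, one_smul] at h2
  rw [← h2, ← (ℛ ℂ a).eq]
  simp only [map_sum, TensorProduct.map_tmul, LinearMap.lTensor_tmul, rid_tmul, map_smul]
  refine Submodule.sum_mem _ fun i hi => Submodule.smul_mem _ _ ?_
  have : (f ^ n) ((f ^ (-n)) ((ℛ ℂ a).left i)) = (ℛ ℂ a).left i := by
    rw [← LinearEquiv.mul_apply, ← zpow_add]; simp
  simp only [LinearEquiv.coe_coe, this]
  exact Submodule.subset_span ⟨i, hi, rfl⟩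

lemma aux_zpow (σ : A ≃ₐ[ℂ] A) (n : ℤ) (a : A) : (σ ^ n) a = (σ.toLinearEquiv ^ n) a := by
  let F : (A ≃ₐ[ℂ] A) →* (A ≃ₗ[ℂ] A) := MonoidHom.mk' AlgEquiv.toLinearEquiv (fun _ _ => rfl)
  exact (LinearEquiv.congr_fun (map_zpow F σ n) a)

end Inv


open TensorProduct HopfAlgebra Coalgebra ComplexOrder

/-- In a `*`-algebraic quantum group `A`, for every `a ∈ A` there is a
finite-dimensional subspace of `A` containing all elements `Sⁿ(a)`, `σⁿ(a)` and `σ'ⁿ(a)`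
for all integers `n`. -/
theorem exists_findim_subspace_antipode_sigma_iterates
    {A : Type*} [Ring A] [HopfAlgebra ℂ A] [StarRing A] [StarModule ℂ A]
    -- compatibility of the comultiplication with the star structure:
    (st : A ⊗[ℂ] A → A ⊗[ℂ] A)
    (hst_add : ∀ z w : A ⊗[ℂ] A, st (z + w) = st z + st w)
    (hst_smul : ∀ (c : ℂ) (z : A ⊗[ℂ] A), st (c • z) = (starRingEnd ℂ c) • st z)
    (hst_tmul : ∀ p q : A, st (p ⊗ₜ[ℂ] q) = (star p) ⊗ₜ[ℂ] (star q))
    (hcomul_star : ∀ a : A, comul (R := ℂ) (star a) = st (comul (R := ℂ) a))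
    -- the antipode is bijective: `Se` is `S` as a linear equivalence
    (Se : A ≃ₗ[ℂ] A) (hSe : ∀ a : A, Se a = antipode (R := ℂ) a)
    (hstar_S : ∀ a : A, star (antipode (R := ℂ) a) = Se.symm (star a))
    -- `ψ` is a faithful positive right integral
    (ψ : A →ₗ[ℂ] ℂ)
    (hψ_inv : ∀ a : A,
      (TensorProduct.lid ℂ A) ((TensorProduct.map ψ LinearMap.id) (comul (R := ℂ) a))
        = ψ a • (1 : A))
    (hψ_pos : ∀ a : A, 0 ≤ ψ (star a * a))
    (hψ_faithful : ∀ a : A, ψ (star a * a) = 0 → a = 0)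
    -- `σ'` is the modular automorphism of `ψ`, `σ` that of `φ := ψ ∘ S`
    (σ' : A ≃ₐ[ℂ] A)
    (hσ' : ∀ a b : A, ψ (a * b) = ψ (b * σ' a))
    (σ : A ≃ₐ[ℂ] A)
    (hσ : ∀ a b : A, ψ (antipode (R := ℂ) (a * b)) = ψ (antipode (R := ℂ) (b * σ a)))
    -- `δ` is the modular element
    (δ : Aˣ)
    (hδ_comul : comul (R := ℂ) (δ : A) = (δ : A) ⊗ₜ[ℂ] (δ : A))
    (hδ_S : antipode (R := ℂ) (δ : A) = ((δ⁻¹ : Aˣ) : A))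
    (hδ_star : star (δ : A) = (δ : A))
    (hδ_σ : σ (δ : A) = (δ : A))
    (hδ_σ' : σ' (δ : A) = (δ : A))
    (hψS : ∀ a : A, ψ (antipode (R := ℂ) a) = ψ (a * ((δ⁻¹ : Aˣ) : A)))
    -- the standard commutation relations
    (hcomm_σσ' : ∀ a : A, σ (σ' a) = σ' (σ a))
    (hcomm_S2σ : ∀ a : A,
      σ (antipode (R := ℂ) (antipode (R := ℂ) a))
        = antipode (R := ℂ) (antipode (R := ℂ) (σ a)))
    (hcomm_S2σ' : ∀ a : A,
      σ' (antipode (R := ℂ) (antipode (R := ℂ) a))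
        = antipode (R := ℂ) (antipode (R := ℂ) (σ' a)))
    (hΔS2 : ∀ a : A,
      comul (R := ℂ) (antipode (R := ℂ) (antipode (R := ℂ) a))
        = (TensorProduct.map σ.toLinearMap σ'.symm.toLinearMap) (comul (R := ℂ) a))
    (hσσ'δ : ∀ a : A, σ (σ' a) = (δ : A) * σ (σ a) * ((δ⁻¹ : Aˣ) : A))
    (a : A) :
    ∃ L : Submodule ℂ A, FiniteDimensional ℂ L ∧
      ∀ n : ℤ, (Se ^ n) a ∈ L ∧ (σ ^ n) a ∈ L ∧ (σ' ^ n) a ∈ L := by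

  -- nondegeneracy
  have nd : ∀ x : A, (∀ b, ψ (b * x) = 0) → x = 0 := fun x hx => hψ_faithful x (hx _)
  have hδinv : ((δ⁻¹ : Aˣ) : A) = 1 := by
    have hc : comul (R := ℂ) ((δ⁻¹ : Aˣ) : A) =
        ((δ⁻¹ : Aˣ) : A) ⊗ₜ[ℂ] ((δ⁻¹ : Aˣ) : A) := by
      have h1 : comul (R := ℂ) ((δ⁻¹ : Aˣ) : A) * comul (R := ℂ) (δ : A) = 1 := by
        rw [← Bialgebra.comul_mul]; simp
      have h2 : comul (R := ℂ) (δ : A) * (((δ⁻¹ : Aˣ) : A) ⊗ₜ[ℂ] ((δ⁻¹ : Aˣ) : A)) = 1 := by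
        rw [hδ_comul]; simp [Algebra.TensorProduct.one_def]
      exact left_inv_eq_right_inv h1 h2
    have h3 := hψ_inv ((δ⁻¹ : Aˣ) : A)
    have h4 : ψ ((δ⁻¹ : Aˣ) : A) = ψ 1 := by
      have := hψS 1
      rw [antipode_one, one_mul] at this
      exact this.symm
    rw [hc, TensorProduct.map_tmul, TensorProduct.lid_tmul, h4, LinearMap.id_apply] at h3
    by_cases h0 : ψ 1 = 0
    · have h10 : (1 : A) = 0 := hψ_faithful 1 (by simpa using h0)
      rw [← mul_one ((δ⁻¹ : Aˣ) : A), h10, mul_zero]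
    · exact smul_right_injective A h0 h3
  have hψS' : ∀ x, ψ (antipode ℂ x) = ψ x := fun x => by rw [hψS, hδinv, mul_one]
  have hσσ : ∀ x, σ' x = σ x := by
    intro x
    rw [← sub_eq_zero]
    apply nd
    intro b
    rw [mul_sub, map_sub, ← hσ', ← hψS' (b * σ x), ← hσ, hψS', sub_self]
  set s : A ≃ₗ[ℂ] A := σ.toLinearEquiv with hs
  have hs_app : ∀ x, s x = σ x := fun _ => rfl
  have hcomm : Commute s (Se * Se) := by
    ext x
    simp only [LinearEquiv.mul_apply, hSe, hs_app, hcomm_S2σ]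
  have hinv : ∀ x : A, TensorProduct.map ((s⁻¹ * (Se * Se) : A ≃ₗ[ℂ] A) : A →ₗ[ℂ] A)
      ((s * (Se * Se) : A ≃ₗ[ℂ] A) : A →ₗ[ℂ] A) (comul (R := ℂ) x) = comul (R := ℂ) x := by
    intro x
    have h1 := hΔS2 x
    rw [aux_comul_S2] at h1
    have h2 := congrArg (TensorProduct.map ((s⁻¹ : A ≃ₗ[ℂ] A) : A →ₗ[ℂ] A) (s : A →ₗ[ℂ] A)) h1
    rw [TensorProduct.map_map, TensorProduct.map_map] at h2
    have e1 : ((s⁻¹ : A ≃ₗ[ℂ] A) : A →ₗ[ℂ] A) ∘ₗ antipode ℂ ∘ₗ antipode ℂ =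
        ((s⁻¹ * (Se * Se) : A ≃ₗ[ℂ] A) : A →ₗ[ℂ] A) := by
      ext y; simp [hSe]
    have e2 : (s : A →ₗ[ℂ] A) ∘ₗ antipode ℂ ∘ₗ antipode ℂ =
        ((s * (Se * Se) : A ≃ₗ[ℂ] A) : A →ₗ[ℂ] A) := by
      ext y; simp [hSe]
    have e3 : ((s⁻¹ : A ≃ₗ[ℂ] A) : A →ₗ[ℂ] A) ∘ₗ σ.toLinearMap = LinearMap.id := by
      ext y; exact s.symm_apply_apply y
    have e4 : (s : A →ₗ[ℂ] A) ∘ₗ σ'.symm.toLinearMap = LinearMap.id := by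
      ext y
      change σ (σ'.symm y) = y
      rw [← hσσ, AlgEquiv.apply_symm_apply]
    rw [e1, e2, e3, e4, TensorProduct.map_id] at h2
    exact h2
  have lf1 := aux_LF_left _ _ hinv
  have lf2 := aux_LF_right _ _ hinv
  have hcc : Commute (s⁻¹ * (Se * Se)) (s * (Se * Se)) := by
    apply Commute.mul_left
    · exact ((Commute.refl s).inv_left).mul_right hcomm.inv_left
    · exact hcomm.symm.mul_right (Commute.refl _)
  have lfS : AuxLF Se := by
    apply AuxLF.of_sq
    apply AuxLF.of_sq
    have := lf1.mul lf2 hcc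
    have e : (s⁻¹ * (Se * Se)) * (s * (Se * Se)) = (Se * Se) * (Se * Se) := by
      rw [← mul_assoc _ s, mul_assoc s⁻¹, ← hcomm.eq, inv_mul_cancel_left]
    rwa [e] at this
  have lfs : AuxLF s := by
    apply AuxLF.of_sq
    have := lf1.inv.mul lf2 hcc.inv_left
    have e : (s⁻¹ * (Se * Se))⁻¹ * (s * (Se * Se)) = s * s := by
      rw [mul_inv_rev, inv_inv, mul_assoc, ← mul_assoc s s, (hcomm.mul_left hcomm).eq,
        inv_mul_cancel_left]
    rwa [e] at this
  obtain ⟨L1, hL1, h1⟩ := lfS a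
  obtain ⟨L2, hL2, h2⟩ := lfs a
  have hσe : σ' = σ := AlgEquiv.ext hσσ
  refine ⟨L1 ⊔ L2, inferInstance, fun n => ⟨Submodule.mem_sup_left (h1 n), ?_, ?_⟩⟩
  · rw [aux_zpow]; exact Submodule.mem_sup_right (h2 n)
  · rw [hσe, aux_zpow]; exact Submodule.mem_sup_right (h2 n)
end

section
/- Let κ := S⁻² ∘ σ and ρ := S² ∘ σ' (both bijections of A). Then for every a ∈ A there exists a finite-dimensional ℂ-subspace L of A containing κⁿ(a) and ρⁿ(a) for every integer n (positive and negative iterates). -/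
open TensorProduct HopfAlgebra Coalgebra

theorem aux_T_R {A : Type*} [Ring A] [HopfAlgebra ℂ A] (φ f : A →ₗ[ℂ] ℂ) (x : A ⊗[ℂ] A) :
    TensorProduct.rid ℂ A (φ.lTensor A (comul (R := ℂ) (TensorProduct.rid ℂ A (f.lTensor A x)))) =
    TensorProduct.rid ℂ A (((TensorProduct.lid ℂ ℂ).toLinearMap ∘ₗ TensorProduct.map φ f).lTensor A
      (TensorProduct.assoc ℂ A A A ((comul (R := ℂ) (A := A)).rTensor A x))) := by
  induction x with
  | zero => simp
  | add x y hx hy => simp only [map_add, hx, hy]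
  | tmul y z =>
    simp only [LinearMap.lTensor_tmul, TensorProduct.rid_tmul, map_smul, LinearMap.rTensor_tmul]
    generalize comul (R := ℂ) y = w
    induction w with
    | zero => simp
    | add x y hx hy => simp only [map_add, smul_add, TensorProduct.add_tmul, hx, hy]
    | tmul p q => simp [smul_smul, mul_comm]

theorem aux_T_L {A : Type*} [Ring A] [HopfAlgebra ℂ A] (φ f : A →ₗ[ℂ] ℂ) (x : A ⊗[ℂ] A) :
    TensorProduct.lid ℂ A (φ.rTensor A (comul (R := ℂ) (TensorProduct.lid ℂ A (f.rTensor A x)))) =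
    TensorProduct.lid ℂ A (((TensorProduct.lid ℂ ℂ).toLinearMap ∘ₗ TensorProduct.map f φ).rTensor A
      ((TensorProduct.assoc ℂ A A A).symm ((comul (R := ℂ) (A := A)).lTensor A x))) := by
  induction x with
  | zero => simp
  | add x y hx hy => simp only [map_add, hx, hy]
  | tmul y z =>
    simp only [LinearMap.rTensor_tmul, TensorProduct.lid_tmul, map_smul, LinearMap.lTensor_tmul]
    generalize comul (R := ℂ) z = w
    induction w with
    | zero => simp
    | add x y hx hy => simp only [map_add, smul_add, TensorProduct.tmul_add, hx, hy]
    | tmul p q => simp [smul_smul]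

theorem aux_fd_R {A : Type*} [Ring A] [Algebra ℂ A] (x : A ⊗[ℂ] A) :
    ∃ W : Submodule ℂ A, FiniteDimensional ℂ W ∧
      ∀ f : A →ₗ[ℂ] ℂ, TensorProduct.rid ℂ A (f.lTensor A x) ∈ W := by
  induction x with
  | zero => exact ⟨⊥, inferInstance, by simp⟩
  | add x y hx hy =>
    obtain ⟨U, _, hU⟩ := hx
    obtain ⟨V, _, hV⟩ := hy
    refine ⟨U ⊔ V, inferInstance, fun f => ?_⟩
    simp only [map_add]
    exact Submodule.add_mem_sup (hU f) (hV f)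
  | tmul y z =>
    refine ⟨Submodule.span ℂ {y}, inferInstance, fun f => ?_⟩
    simpa using Submodule.smul_mem _ _ (Submodule.mem_span_singleton_self y)

theorem aux_fd_L {A : Type*} [Ring A] [Algebra ℂ A] (x : A ⊗[ℂ] A) :
    ∃ W : Submodule ℂ A, FiniteDimensional ℂ W ∧
      ∀ f : A →ₗ[ℂ] ℂ, TensorProduct.lid ℂ A (f.rTensor A x) ∈ W := by
  induction x with
  | zero => exact ⟨⊥, inferInstance, by simp⟩
  | add x y hx hy =>
    obtain ⟨U, _, hU⟩ := hx
    obtain ⟨V, _, hV⟩ := hy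
    refine ⟨U ⊔ V, inferInstance, fun f => ?_⟩
    simp only [map_add]
    exact Submodule.add_mem_sup (hU f) (hV f)
  | tmul y z =>
    refine ⟨Submodule.span ℂ {z}, inferInstance, fun f => ?_⟩
    simpa using Submodule.smul_mem _ _ (Submodule.mem_span_singleton_self z)

theorem aux_R {A : Type*} [Ring A] [HopfAlgebra ℂ A] (a : A) :
    ∃ V : Submodule ℂ A, FiniteDimensional ℂ V ∧ a ∈ V ∧ ∀ φ : A →ₗ[ℂ] ℂ, ∀ v ∈ V,
      TensorProduct.rid ℂ A (φ.lTensor A (comul (R := ℂ) v)) ∈ V := by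
  obtain ⟨W, _, hW⟩ := aux_fd_R (comul (R := ℂ) a)
  let F : (A →ₗ[ℂ] ℂ) →ₗ[ℂ] A :=
    { toFun := fun f => TensorProduct.rid ℂ A (f.lTensor A (comul (R := ℂ) a))
      map_add' := by intro f g; simp [LinearMap.lTensor_add]
      map_smul' := by intro c f; simp [LinearMap.lTensor_smul] }
  refine ⟨LinearMap.range F, ?_, ⟨counit, ?_⟩, ?_⟩
  · refine Submodule.finiteDimensional_of_le (S₂ := W) ?_
    rintro _ ⟨f, rfl⟩
    exact hW f
  · simp [F]
  · rintro φ _ ⟨f, rfl⟩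
    refine ⟨((TensorProduct.lid ℂ ℂ).toLinearMap ∘ₗ TensorProduct.map φ f) ∘ₗ comul, ?_⟩
    change TensorProduct.rid ℂ A _ = TensorProduct.rid ℂ A (φ.lTensor A (comul (R := ℂ)
      (TensorProduct.rid ℂ A (f.lTensor A (comul (R := ℂ) a)))))
    rw [aux_T_R, coassoc_apply, LinearMap.lTensor_comp_apply]

theorem aux_L {A : Type*} [Ring A] [HopfAlgebra ℂ A] (a : A) :
    ∃ V : Submodule ℂ A, FiniteDimensional ℂ V ∧ a ∈ V ∧ ∀ φ : A →ₗ[ℂ] ℂ, ∀ v ∈ V,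
      TensorProduct.lid ℂ A (φ.rTensor A (comul (R := ℂ) v)) ∈ V := by
  obtain ⟨W, _, hW⟩ := aux_fd_L (comul (R := ℂ) a)
  let F : (A →ₗ[ℂ] ℂ) →ₗ[ℂ] A :=
    { toFun := fun f => TensorProduct.lid ℂ A (f.rTensor A (comul (R := ℂ) a))
      map_add' := by intro f g; simp [LinearMap.rTensor_add]
      map_smul' := by intro c f; simp [LinearMap.rTensor_smul] }
  refine ⟨LinearMap.range F, ?_, ⟨counit, ?_⟩, ?_⟩
  · refine Submodule.finiteDimensional_of_le (S₂ := W) ?_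
    rintro _ ⟨f, rfl⟩
    exact hW f
  · simp [F]
  · rintro φ _ ⟨f, rfl⟩
    refine ⟨((TensorProduct.lid ℂ ℂ).toLinearMap ∘ₗ TensorProduct.map f φ) ∘ₗ comul, ?_⟩
    change TensorProduct.lid ℂ A _ = TensorProduct.lid ℂ A (φ.rTensor A (comul (R := ℂ)
      (TensorProduct.lid ℂ A (f.rTensor A (comul (R := ℂ) a)))))
    rw [aux_T_L, coassoc_symm_apply, LinearMap.rTensor_comp_apply]

theorem aux_zpow_s6 {A : Type*} [AddCommGroup A] [Module ℂ A] (e : A ≃ₗ[ℂ] A) (V : Submodule ℂ A)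
    [FiniteDimensional ℂ V] (h : ∀ v ∈ V, e v ∈ V) (a : A) (ha : a ∈ V) (n : ℤ) :
    (e ^ n) a ∈ V := by
  have hmap : V.map e.toLinearMap = V := by
    apply Submodule.eq_of_le_of_finrank_eq
    · rintro _ ⟨v, hv, rfl⟩
      exact h v hv
    · exact LinearEquiv.finrank_map_eq e V
  have hinv : ∀ v ∈ V, e⁻¹ v ∈ V := by
    intro v hv
    rw [← hmap] at hv
    obtain ⟨w, hw, rfl⟩ := hv
    have : e⁻¹ (e w) = w := e.symm_apply_apply w
    exact this.symm ▸ hw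
  induction n with
  | zero => simpa using ha
  | succ n ih =>
    rw [add_comm, zpow_add, zpow_one]
    exact h _ ih
  | pred n ih =>
    rw [sub_eq_add_neg, add_comm, zpow_add, zpow_neg_one]
    exact hinv _ ih

/-- Let `A` be a Hopf algebra over `ℂ` with bijective antipode `S`, and let
`σ`, `σ'` be algebra automorphisms with `Δ(S(S a)) = (σ ⊗ σ'⁻¹)(Δ a)` for all `a`.
Put `κ := S⁻² ∘ σ` and `ρ := S² ∘ σ'`.  Then for every `a ∈ A` there is a finite-dimensional
subspace of `A` containing all elements `κⁿ(a)` and `ρⁿ(a)` for all integers `n`. -/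
theorem exists_findim_subspace_kappa_rho_iterates
    {A : Type*} [Ring A] [HopfAlgebra ℂ A]
    -- the antipode is bijective: `Se` is `S` as a linear equivalence
    (Se : A ≃ₗ[ℂ] A) (hSe : ∀ a : A, Se a = antipode (R := ℂ) a)
    (σ : A ≃ₐ[ℂ] A) (σ' : A ≃ₐ[ℂ] A)
    (hΔS2 : ∀ a : A,
      comul (R := ℂ) (antipode (R := ℂ) (antipode (R := ℂ) a))
        = (TensorProduct.map σ.toLinearMap σ'.symm.toLinearMap) (comul (R := ℂ) a))
    -- `κ := S⁻² ∘ σ` and `ρ := S² ∘ σ'` as bijections of `A`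
    (κ ρ : A ≃ₗ[ℂ] A)
    (hκ : ∀ a : A, κ a = Se.symm (Se.symm (σ a)))
    (hρ : ∀ a : A, ρ a = Se (Se (σ' a)))
    (a : A) :
    ∃ L : Submodule ℂ A, FiniteDimensional ℂ L ∧
      ∀ n : ℤ, (κ ^ n) a ∈ L ∧ (ρ ^ n) a ∈ L := by
  have h1 : ∀ v, κ⁻¹ v = TensorProduct.rid ℂ A
      ((counit (R := ℂ) ∘ₗ σ'.symm.toLinearMap).lTensor A (comul (R := ℂ) v)) := by
    intro v
    have key : κ (TensorProduct.rid ℂ A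
      ((counit (R := ℂ) ∘ₗ σ'.symm.toLinearMap).lTensor A (comul (R := ℂ) v))) = v := by
      rw [hκ, LinearEquiv.symm_apply_eq, LinearEquiv.symm_apply_eq, hSe, hSe]
      have h := congrArg (fun x => TensorProduct.rid ℂ A ((counit (R := ℂ)).lTensor A x)) (hΔS2 v)
      simp only [lTensor_counit_comul, TensorProduct.rid_tmul, one_smul] at h
      rw [h]
      generalize comul (R := ℂ) v = x
      induction x with
      | zero => simp
      | add x y hx hy => simp only [map_add, hx, hy]
      | tmul p q => simp
    exact κ.symm_apply_eq.2 key.symm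
  have h2 : ∀ v, σ' (Se (Se v)) = TensorProduct.lid ℂ A
      ((counit (R := ℂ) ∘ₗ σ.toLinearMap).rTensor A (comul (R := ℂ) v)) := by
    intro v
    have h := congrArg (fun x => TensorProduct.lid ℂ A ((counit (R := ℂ)).rTensor A x)) (hΔS2 v)
    simp only [rTensor_counit_comul, TensorProduct.lid_tmul, one_smul] at h
    rw [hSe, hSe, h]
    generalize comul (R := ℂ) v = x
    induction x with
    | zero => simp
    | add x y hx hy => simp only [map_add, hx, hy]
    | tmul p q => simp
  obtain ⟨V, _, haV, hV⟩ := aux_R a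
  obtain ⟨W, _, haW, hW⟩ := aux_L (Se.symm (Se.symm a))
  let U : Submodule ℂ A := W.map (Se.trans Se).toLinearMap
  have hU : ∀ u ∈ U, ρ u ∈ U := by
    rintro _ ⟨w, hw, rfl⟩
    refine ⟨σ' (Se (Se w)), ?_, ?_⟩
    · rw [h2]
      exact hW _ _ hw
    · simp [hρ]
  have haU : a ∈ U := ⟨_, haW, by simp⟩
  refine ⟨V ⊔ U, inferInstance, fun n => ⟨?_, ?_⟩⟩
  · apply Submodule.mem_sup_left
    have := aux_zpow_s6 κ⁻¹ V (fun v hv => by rw [h1]; exact hV _ _ hv) a haV (-n)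
    simpa using this
  · exact Submodule.mem_sup_right (aux_zpow_s6 ρ U hU a haU n)
end

section
/- For every t ∈ ℝ there exists a unique ℂ-linear map u_t : A → A such that u_t(a) = ((λ : ℂ) ^ (Complex.I * t)) • a whenever λ is a strictly positive real number and a ∈ A satisfies δ * a = λ • a. (The map u_t represents left multiplication by δ^{it}.) -/
open TensorProduct HopfAlgebra Coalgebra ComplexOrder

/-- Let `A` be a Hopf `*`-algebra over `ℂ` with a faithful positive linear
functional `ψ` and a self-adjoint invertible element `δ` such that `A` is spanned by
eigenvectors of left multiplication by `δ` with strictly positive eigenvalues.  Then for every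
`t ∈ ℝ` there is a unique `ℂ`-linear map `u_t : A → A` (representing left multiplication by
`δ^{it}`) with `u_t a = λ^{it} • a` whenever `δ * a = λ • a` with `λ > 0`. -/
theorem exists_unique_delta_it
    {A : Type*} [Ring A] [HopfAlgebra ℂ A] [StarRing A] [StarModule ℂ A]
    -- `ψ` is a faithful positive linear functional
    (ψ : A →ₗ[ℂ] ℂ)
    (hψ_pos : ∀ a : A, 0 ≤ ψ (star a * a))
    (hψ_faithful : ∀ a : A, ψ (star a * a) = 0 → a = 0)
    -- `δ` is self-adjoint and invertible
    (δ : Aˣ)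
    (hδ_star : star (δ : A) = (δ : A))
    -- `A` is spanned by eigenvectors of left multiplication by `δ`
    (hspan : Submodule.span ℂ
        {a : A | ∃ lam : ℝ, 0 < lam ∧ (δ : A) * a = (lam : ℂ) • a} = ⊤)
    (t : ℝ) :
    ∃! u : A →ₗ[ℂ] A, ∀ (lam : ℝ) (a : A), 0 < lam → (δ : A) * a = (lam : ℂ) • a →
      u a = ((lam : ℂ) ^ (Complex.I * (t : ℂ))) • a := by
  classical
  have hind := Module.End.eigenspaces_iSupIndep (LinearMap.mulLeft ℂ (δ : A))
  have hmem : ∀ (c : ℂ) (a : A), (δ : A) * a = c • a →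
      a ∈ Module.End.eigenspace (LinearMap.mulLeft ℂ (δ : A)) c := by
    intro c a h
    rw [Module.End.mem_eigenspace_iff]
    exact h
  have htop : (⨆ c : ℂ, Module.End.eigenspace (LinearMap.mulLeft ℂ (δ : A)) c) = ⊤ := by
    rw [eq_top_iff, ← hspan, Submodule.span_le]
    rintro a ⟨lam, _, h⟩
    exact Submodule.mem_iSup_of_mem (lam : ℂ) (hmem _ _ h)
  have hint := DirectSum.isInternal_submodule_of_iSupIndep_of_iSup_eq_top hind htop
  let e := LinearEquiv.ofBijective (DirectSum.coeLinearMap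
    (fun c : ℂ => Module.End.eigenspace (LinearMap.mulLeft ℂ (δ : A)) c)) hint
  let v := DirectSum.toModule ℂ ℂ A (fun c : ℂ =>
    (c ^ (Complex.I * (t : ℂ))) • (Module.End.eigenspace (LinearMap.mulLeft ℂ (δ : A)) c).subtype)
  refine ⟨v ∘ₗ e.symm.toLinearMap, ?_, ?_⟩
  · intro lam a _ h
    have he : e.symm a = DirectSum.lof ℂ ℂ
        (fun c : ℂ => Module.End.eigenspace (LinearMap.mulLeft ℂ (δ : A)) c) (lam : ℂ)
          ⟨a, hmem _ _ h⟩ := by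
      rw [LinearEquiv.symm_apply_eq]
      exact (DirectSum.coeLinearMap_lof (fun c : ℂ => Module.End.eigenspace (LinearMap.mulLeft ℂ (δ : A)) c) (lam : ℂ) ⟨a, hmem _ _ h⟩).symm
    change v (e.symm a) = _
    rw [he]
    simp [v]
  · intro w hw
    refine LinearMap.ext_on hspan ?_
    rintro a ⟨lam, hl, h⟩
    rw [hw lam a hl h]
    have he : e.symm a = DirectSum.lof ℂ ℂ
        (fun c : ℂ => Module.End.eigenspace (LinearMap.mulLeft ℂ (δ : A)) c) (lam : ℂ)
          ⟨a, hmem _ _ h⟩ := by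
      rw [LinearEquiv.symm_apply_eq]
      exact (DirectSum.coeLinearMap_lof (fun c : ℂ => Module.End.eigenspace (LinearMap.mulLeft ℂ (δ : A)) c) (lam : ℂ) ⟨a, hmem _ _ h⟩).symm
    change _ = v (e.symm a)
    rw [he]
    simp [v]
end

section
/- Let λ, μ ∈ ℂ and a, c ∈ A with δ * a = λ • a and δ * c = μ • c. Then the elementary tensor a ⊗ c in A ⊗[ℂ] A belongs to the ℂ-linear span of the set {Δ(p) * (1 ⊗ q) : p, q ∈ A, δ * p = (λ * μ) • p}. (This is the algebraic core of the identity Δ(δ^{it}) = δ^{it} ⊗ δ^{it}.) -/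
open TensorProduct HopfAlgebra Coalgebra

/-- `p ⊗ q ↦ p₁ ⊗ f(p₂) q`. -/
noncomputable def galoisAux {A : Type*} [Ring A] [HopfAlgebra ℂ A] (f : A →ₗ[ℂ] A) :
    A ⊗[ℂ] A →ₗ[ℂ] A ⊗[ℂ] A :=
  (LinearMap.mul' ℂ A ∘ₗ f.rTensor A).lTensor A ∘ₗ
    (TensorProduct.assoc ℂ A A A).toLinearMap ∘ₗ (comul (R := ℂ) (A := A)).rTensor A

theorem galoisAux_tmul {A : Type*} [Ring A] [HopfAlgebra ℂ A] (f : A →ₗ[ℂ] A) (p q : A) :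
    galoisAux f (p ⊗ₜ q) = f.lTensor A (comul p) * ((1 : A) ⊗ₜ[ℂ] q) := by
  simp only [galoisAux, LinearMap.comp_apply, LinearMap.rTensor_tmul]
  induction comul (R := ℂ) p using TensorProduct.induction_on with
  | zero => simp
  | tmul x y => simp
  | add x y hx hy => simp only [TensorProduct.add_tmul, map_add, add_mul, hx, hy]

theorem galoisAux_mul {A : Type*} [Ring A] [HopfAlgebra ℂ A] (f : A →ₗ[ℂ] A)
    (t : A ⊗[ℂ] A) (q : A) :
    galoisAux f (t * ((1 : A) ⊗ₜ[ℂ] q)) = galoisAux f t * ((1 : A) ⊗ₜ[ℂ] q) := by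
  induction t using TensorProduct.induction_on with
  | zero => simp
  | tmul x y =>
    rw [Algebra.TensorProduct.tmul_mul_tmul, galoisAux_tmul, galoisAux_tmul, mul_assoc,
      Algebra.TensorProduct.tmul_mul_tmul, mul_one, one_mul]
  | add x y hx hy => simp only [map_add, add_mul, hx, hy]

theorem galoisAux_comul {A : Type*} [Ring A] [HopfAlgebra ℂ A] (f g : A →ₗ[ℂ] A) (p : A) :
    galoisAux f (g.lTensor A (comul p)) =
      (LinearMap.mul' ℂ A ∘ₗ TensorProduct.map f g ∘ₗ comul).lTensor A (comul p) := by
  rw [LinearMap.lTensor_comp, LinearMap.lTensor_comp, LinearMap.comp_apply, LinearMap.comp_apply,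
    ← Coalgebra.coassoc_apply]
  induction comul (R := ℂ) p using TensorProduct.induction_on with
  | zero => simp
  | tmul x y =>
    rw [LinearMap.lTensor_tmul, galoisAux_tmul, LinearMap.rTensor_tmul]
    induction comul (R := ℂ) x using TensorProduct.induction_on with
    | zero => simp
    | tmul x y => simp
    | add x y hx hy => simp only [TensorProduct.add_tmul, map_add, add_mul, hx, hy]
  | add x y hx hy => simp only [map_add, hx, hy]

theorem galoisAux_comp {A : Type*} [Ring A] [HopfAlgebra ℂ A] (f g : A →ₗ[ℂ] A)
    (h : LinearMap.mul' ℂ A ∘ₗ TensorProduct.map f g ∘ₗ comul =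
      Algebra.linearMap ℂ A ∘ₗ counit) (t : A ⊗[ℂ] A) :
    galoisAux f (galoisAux g t) = t := by
  induction t using TensorProduct.induction_on with
  | zero => simp
  | tmul x y =>
    rw [galoisAux_tmul g, galoisAux_mul, galoisAux_comul, h, LinearMap.lTensor_comp,
      LinearMap.comp_apply, Coalgebra.lTensor_counit_comul]
    simp
  | add x y hx hy => simp only [map_add, hx, hy]

/-- Let `A` be a Hopf algebra over `ℂ` with bijective antipode and let `δ` be
an invertible element with `Δ(δ) = δ ⊗ δ`.  If `δ * a = λ • a` and `δ * c = μ • c`, then the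
elementary tensor `a ⊗ c` lies in the span of the set `{Δ(p)(1 ⊗ q) : δ * p = (λμ) • p}`.
(This is the algebraic core of the identity `Δ(δ^{it}) = δ^{it} ⊗ δ^{it}`.) -/
theorem tmul_mem_span_comul_eigen
    {A : Type*} [Ring A] [HopfAlgebra ℂ A]
    -- the antipode is bijective: `Se` is `S` as a linear equivalence
    (Se : A ≃ₗ[ℂ] A) (hSe : ∀ a : A, Se a = antipode (R := ℂ) a)
    -- `δ` is a group-like invertible element
    (δ : Aˣ)
    (hδ_comul : comul (R := ℂ) (δ : A) = (δ : A) ⊗ₜ[ℂ] (δ : A))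
    (lam mu : ℂ) (a c : A)
    (ha : (δ : A) * a = lam • a) (hc : (δ : A) * c = mu • c) :
    a ⊗ₜ[ℂ] c ∈ Submodule.span ℂ
      {x : A ⊗[ℂ] A | ∃ p q : A, (δ : A) * p = (lam * mu) • p ∧
        x = comul (R := ℂ) p * ((1 : A) ⊗ₜ[ℂ] q)} := by
  have h1 : ∀ t : A ⊗[ℂ] A, galoisAux LinearMap.id (galoisAux (antipode ℂ) t) = t :=
    galoisAux_comp _ _ mul_antipode_lTensor_comul
  have h2 : ∀ t : A ⊗[ℂ] A, galoisAux (antipode ℂ) (galoisAux LinearMap.id t) = t :=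
    galoisAux_comp _ _ mul_antipode_rTensor_comul
  have hT : ∀ p q : A, galoisAux LinearMap.id (p ⊗ₜ[ℂ] q) =
      comul (R := ℂ) p * ((1 : A) ⊗ₜ[ℂ] q) := by
    intro p q
    rw [galoisAux_tmul, LinearMap.lTensor_id, LinearMap.id_apply]
  have hcomm : ∀ t : A ⊗[ℂ] A,
      galoisAux LinearMap.id ((LinearMap.mulLeft ℂ (δ : A)).rTensor A t) =
        ((δ : A) ⊗ₜ[ℂ] (δ : A)) * galoisAux LinearMap.id t := by
    intro t
    induction t using TensorProduct.induction_on with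
    | zero => simp
    | tmul x y =>
      rw [LinearMap.rTensor_tmul, LinearMap.mulLeft_apply, hT, hT, Bialgebra.comul_mul, hδ_comul,
        mul_assoc]
    | add x y hx hy => simp only [map_add, mul_add, hx, hy]
  obtain ⟨t, ht⟩ : ∃ t, galoisAux LinearMap.id t = a ⊗ₜ[ℂ] c := ⟨_, h1 _⟩
  let L : A →ₗ[ℂ] A := LinearMap.mulLeft ℂ (δ : A) - (lam * mu) • LinearMap.id
  have hL : L.rTensor A t = 0 := by
    apply Function.LeftInverse.injective h2
    rw [map_zero, LinearMap.rTensor_sub, LinearMap.rTensor_smul, LinearMap.rTensor_id,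
      LinearMap.sub_apply, LinearMap.smul_apply, LinearMap.id_apply, map_sub, hcomm, map_smul, ht,
      Algebra.TensorProduct.tmul_mul_tmul, ha, hc, TensorProduct.smul_tmul_smul, sub_self]
  have hex := Module.Flat.rTensor_exact (M := A) (f := (LinearMap.ker L).subtype) (g := L)
    (LinearMap.exact_subtype_ker_map L)
  obtain ⟨s, rfl⟩ := (hex t).1 hL
  rw [← ht]
  clear ht hL
  induction s using TensorProduct.induction_on with
  | zero => simp
  | tmul x y =>
    refine Submodule.subset_span ⟨x, y, ?_, ?_⟩
    · have := x.2
      rw [LinearMap.mem_ker] at this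
      exact sub_eq_zero.1 this
    · rw [LinearMap.rTensor_tmul, hT]; rfl
  | add x y hx hy =>
    rw [map_add, map_add]
    exact Submodule.add_mem _ hx hy
end

section
/- The following two identities hold: (i) ψ(u * x) = ψ(S(x) * S(u) * δ⁻¹) for all u, x ∈ A; (ii) ψ(δ⁻¹ * S⁻¹(y) * x) = ψ(S(x) * y) for all x, y ∈ A. (These are the algebraic content of the formulas T̂Λ(a) = Λ(S(star a) δ⁻¹) and T̂*Λ(a) = Λ(star (S a)) for the modular involution of the dual integral on the GNS space of ψ.) -/
open TensorProduct HopfAlgebra Coalgebra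

/-- Let `A` be a Hopf algebra over `ℂ` with bijective antipode `S`, `ψ` a
linear functional and `δ` an invertible element with `S(δ) = δ⁻¹`, `ψ(S(a)) = ψ(a δ⁻¹)` and
`ψ(δ a) = ψ(a δ)` for all `a`.  Then
(i) `ψ(u x) = ψ(S(x) S(u) δ⁻¹)` for all `u, x`, and
(ii) `ψ(δ⁻¹ S⁻¹(y) x) = ψ(S(x) y)` for all `x, y`.
(These express the formulas `T̂Λ(a) = Λ(S(a*)δ⁻¹)` and `T̂*Λ(a) = Λ(S(a)*)`.) -/
theorem dual_modular_involution_formulas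
    {A : Type*} [Ring A] [HopfAlgebra ℂ A]
    -- the antipode is bijective: `Se` is `S` as a linear equivalence
    (Se : A ≃ₗ[ℂ] A) (hSe : ∀ a : A, Se a = antipode (R := ℂ) a)
    (ψ : A →ₗ[ℂ] ℂ)
    (δ : Aˣ)
    (hδ_S : antipode (R := ℂ) (δ : A) = ((δ⁻¹ : Aˣ) : A))
    (hψS : ∀ a : A, ψ (antipode (R := ℂ) a) = ψ (a * ((δ⁻¹ : Aˣ) : A)))
    (hψδ : ∀ a : A, ψ ((δ : A) * a) = ψ (a * (δ : A))) :
    (∀ u x : A, ψ (u * x)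
        = ψ (antipode (R := ℂ) x * antipode (R := ℂ) u * ((δ⁻¹ : Aˣ) : A))) ∧
    (∀ x y : A, ψ (((δ⁻¹ : Aˣ) : A) * Se.symm y * x) = ψ (antipode (R := ℂ) x * y)) := by
  constructor
  · intro u x
    rw [← antipode_mul_antidistrib, ← hδ_S, ← antipode_mul_antidistrib, hψS, mul_assoc, hψδ]
    simp [mul_assoc]
  · intro x y
    obtain ⟨w, rfl⟩ := Se.surjective y
    rw [Se.symm_apply_apply, hSe, ← antipode_mul_antidistrib, hψS]
    have h := hψδ (((δ⁻¹ : Aˣ) : A) * w * x * ((δ⁻¹ : Aˣ) : A))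
    simp only [mul_assoc, Units.mul_inv_cancel_left, Units.inv_mul, mul_one] at h ⊢
    exact h.symm
end

section
/- For every a ∈ A one has (id ⊗ (ε ∘ σ⁻¹))(Δ a) = S(S(σ⁻¹(a))), i.e. in Sweedler notation Σ ε(σ⁻¹(a₍₂₎)) • a₍₁₎ = S²(σ⁻¹(a)), where the left-hand side is the image of Δ(a) under the linear map A ⊗[ℂ] A → A induced by id on the first factor and the functional ε ∘ σ⁻¹ on the second. (This is the algebraic form of the formula δ̂ Λ(a) = Λ(S² σ⁻¹(a)) for the action of the dual modular element.) -/
open TensorProduct HopfAlgebra Coalgebra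

/-- Let `A` be a Hopf algebra over `ℂ` and `σ` an algebra automorphism with
`Δ(σ(a)) = (S² ⊗ σ)(Δ(a))` for all `a`.  Then `(id ⊗ (ε ∘ σ⁻¹))(Δ a) = S²(σ⁻¹(a))`, i.e. in
Sweedler notation `Σ ε(σ⁻¹(a₍₂₎)) • a₍₁₎ = S²(σ⁻¹(a))`.  (This is the algebraic form of
`δ̂ Λ(a) = Λ(S² σ⁻¹(a))`.) -/
theorem id_tensor_counit_sigma_inv_comul
    {A : Type*} [Ring A] [HopfAlgebra ℂ A]
    (σ : A ≃ₐ[ℂ] A)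
    (hΔσ : ∀ a : A, comul (R := ℂ) (σ a)
      = (TensorProduct.map ((antipode (R := ℂ)) ∘ₗ (antipode (R := ℂ) (A := A)))
          σ.toLinearMap) (comul (R := ℂ) a))
    (a : A) :
    (TensorProduct.rid ℂ A)
        ((TensorProduct.map LinearMap.id ((counit (R := ℂ)) ∘ₗ σ.symm.toLinearMap))
          (comul (R := ℂ) a))
      = antipode (R := ℂ) (antipode (R := ℂ) (σ.symm a)) := by
  obtain ⟨b, rfl⟩ := σ.surjective a
  have hσ : ((counit (R := ℂ) (A := A)) ∘ₗ σ.symm.toLinearMap) ∘ₗ σ.toLinearMap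
      = LinearMap.id ∘ₗ counit (R := ℂ) (A := A) := by
    ext x
    simp
  rw [hΔσ, ← LinearMap.comp_apply (TensorProduct.map _ _), ← TensorProduct.map_comp, hσ,
    LinearMap.id_comp (antipode (R := ℂ) ∘ₗ antipode (R := ℂ) (A := A)),
    ← LinearMap.comp_id (antipode (R := ℂ) ∘ₗ antipode (R := ℂ) (A := A)),
    TensorProduct.map_comp, LinearMap.comp_apply]
  have h := Coalgebra.lTensor_counit_comul (R := ℂ) b
  rw [LinearMap.lTensor] at h
  rw [h]
  simp
end

section
/- Let W : A ⊗[ℂ] A → A ⊗[ℂ] A be the ℂ-linear map determined by W(p ⊗ q) = Δ(p) * (1 ⊗ q), and let θ : A ⊗[ℂ] A → A ⊗[ℂ] A be the conjugate-linear map (ℝ-linear, conjugating complex scalars) determined on elementary tensors by θ(p ⊗ q) = (star p) ⊗ (S(star q) * δ⁻¹). Then W ∘ θ ∘ W = θ; equivalently, for all x, y ∈ A, in Sweedler notation Σ Δ(star x₍₁₎) * (1 ⊗ S(star (x₍₂₎ * y)) * δ⁻¹) = (star x) ⊗ (S(star y) * δ⁻¹). (This is the algebraic content of the relation V*(T ⊗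 T̂) = (T ⊗ T̂)V for the right regular representation V and the modular involutions T, T̂.) -/
open TensorProduct HopfAlgebra Coalgebra

lemma W_aux {A : Type*} [Ring A] [HopfAlgebra ℂ A]
    (W : A ⊗[ℂ] A →ₗ[ℂ] A ⊗[ℂ] A)
    (hW : ∀ p q : A, W (p ⊗ₜ[ℂ] q) = comul (R := ℂ) p * ((1 : A) ⊗ₜ[ℂ] q)) (c p : A) :
    W ((LinearMap.mulRight ℂ c ∘ₗ antipode ℂ).lTensor A (comul (R := ℂ) p)) = p ⊗ₜ[ℂ] c := by
  have h1 : ∀ t : A ⊗[ℂ] A,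
      W ((LinearMap.mulRight ℂ c ∘ₗ antipode ℂ).lTensor A t) =
      (LinearMap.mulRight ℂ c ∘ₗ LinearMap.mul' ℂ A ∘ₗ (antipode ℂ).lTensor A).lTensor A
        (TensorProduct.assoc ℂ A A A ((comul (R := ℂ)).rTensor A t)) := by
    intro t
    induction t with
    | zero => simp
    | add a b ha hb => simp only [map_add, ha, hb]
    | tmul a b =>
      simp only [LinearMap.lTensor_tmul, LinearMap.rTensor_tmul, hW]
      generalize comul (R := ℂ) a = u
      induction u with
      | zero => simp
      | add a b ha hb => simp only [map_add, add_mul, add_tmul, ha, hb]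
      | tmul d e => simp [mul_assoc]
  rw [h1, coassoc_apply, ← LinearMap.comp_apply, ← LinearMap.lTensor_comp]
  have h2 : (LinearMap.mulRight ℂ c ∘ₗ LinearMap.mul' ℂ A ∘ₗ (antipode ℂ).lTensor A) ∘ₗ comul
      = (LinearMap.toSpanSingleton ℂ A c) ∘ₗ counit := by
    ext a
    simp [Algebra.smul_def]
  rw [h2, LinearMap.lTensor_comp, LinearMap.comp_apply, lTensor_counit_comul]
  simp

/-- Let `A` be a Hopf `*`-algebra over `ℂ` with bijective antipode and `δ` an
invertible element.  Let `W` be the `ℂ`-linear map on `A ⊗ A` with `W(p ⊗ q) = Δ(p)(1 ⊗ q)` and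
`θ` the conjugate-linear map with `θ(p ⊗ q) = (star p) ⊗ (S(star q) δ⁻¹)`.  Then
`W ∘ θ ∘ W = θ`.  (This is the algebraic content of `V*(T ⊗ T̂) = (T ⊗ T̂)V`.) -/
theorem W_theta_W_eq_theta
    {A : Type*} [Ring A] [HopfAlgebra ℂ A] [StarRing A] [StarModule ℂ A]
    -- compatibility of the comultiplication with the star structure:
    (st : A ⊗[ℂ] A → A ⊗[ℂ] A)
    (hst_add : ∀ z w : A ⊗[ℂ] A, st (z + w) = st z + st w)
    (hst_smul : ∀ (c : ℂ) (z : A ⊗[ℂ] A), st (c • z) = (starRingEnd ℂ c) • st z)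
    (hst_tmul : ∀ p q : A, st (p ⊗ₜ[ℂ] q) = (star p) ⊗ₜ[ℂ] (star q))
    (hcomul_star : ∀ a : A, comul (R := ℂ) (star a) = st (comul (R := ℂ) a))
    -- the antipode is bijective: `Se` is `S` as a linear equivalence
    (Se : A ≃ₗ[ℂ] A) (hSe : ∀ a : A, Se a = antipode (R := ℂ) a)
    (hstar_S : ∀ a : A, star (antipode (R := ℂ) a) = Se.symm (star a))
    (δ : Aˣ)
    -- `W` is the `ℂ`-linear map determined by `W(p ⊗ q) = Δ(p)(1 ⊗ q)`
    (W : A ⊗[ℂ] A →ₗ[ℂ] A ⊗[ℂ] A)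
    (hW : ∀ p q : A, W (p ⊗ₜ[ℂ] q) = comul (R := ℂ) p * ((1 : A) ⊗ₜ[ℂ] q))
    -- `θ` is the conjugate-linear map determined by `θ(p ⊗ q) = (star p) ⊗ (S(star q) δ⁻¹)`
    (θ : A ⊗[ℂ] A → A ⊗[ℂ] A)
    (hθ_add : ∀ z w : A ⊗[ℂ] A, θ (z + w) = θ z + θ w)
    (hθ_smul : ∀ (c : ℂ) (z : A ⊗[ℂ] A), θ (c • z) = (starRingEnd ℂ c) • θ z)
    (hθ_tmul : ∀ p q : A,
      θ (p ⊗ₜ[ℂ] q) = (star p) ⊗ₜ[ℂ] (antipode (R := ℂ) (star q) * ((δ⁻¹ : Aˣ) : A))) :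
    ∀ z : A ⊗[ℂ] A, W (θ (W z)) = θ z := by
  intro z
  have z0 : θ 0 = 0 := by simpa using hθ_smul 0 0
  have s0 : st 0 = 0 := by simpa using hst_smul 0 0
  induction z with
  | zero => simp [z0]
  | add a b ha hb => rw [map_add, hθ_add, map_add, ha, hb, hθ_add]
  | tmul x y =>
    have h : ∀ t : A ⊗[ℂ] A, θ (t * ((1 : A) ⊗ₜ[ℂ] y)) =
        (LinearMap.mulRight ℂ (antipode ℂ (star y) * ((δ⁻¹ : Aˣ) : A)) ∘ₗ
          antipode ℂ).lTensor A (st t) := by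
      intro t
      induction t with
      | zero => simp [z0, s0]
      | add a b ha hb => rw [add_mul, hθ_add, hst_add, map_add, ha, hb]
      | tmul a b => simp [hθ_tmul, hst_tmul, antipode_mul_antidistrib, mul_assoc]
    rw [hW, h, ← hcomul_star, W_aux W hW, hθ_tmul]
end

section
/- For all x, x', y, y' ∈ A one has (ψ ⊗ ψ)((1 ⊗ star y') * Δ((star x') * x) * (1 ⊗ y)) = ψ((star x') * x) * ψ((star y') * y), where ψ ⊗ ψ denotes the linear functional on A ⊗[ℂ] A induced by ψ on each factor. (This identity says that the map Λ(x) ⊗ Λ(y) ↦ (Λ ⊗ Λ)(Δ(x)(1 ⊗ y)) preserves the inner products induced by ψ, i.e. that the right regular representation V is a well-defined isometry.) -/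
open TensorProduct HopfAlgebra Coalgebra

/-- Let `A` be a Hopf `*`-algebra over `ℂ` and `ψ` a right integral.  Then
`(ψ ⊗ ψ)((1 ⊗ y'*) Δ(x'* x) (1 ⊗ y)) = ψ(x'* x) ψ(y'* y)` for all `x, x', y, y' ∈ A`.
(This says that `Λ(x) ⊗ Λ(y) ↦ (Λ ⊗ Λ)(Δ(x)(1 ⊗ y))` preserves the inner products induced
by `ψ`, i.e. that the right regular representation `V` is a well-defined isometry.) -/
theorem right_regular_representation_isometry
    {A : Type*} [Ring A] [HopfAlgebra ℂ A] [StarRing A] [StarModule ℂ A]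
    -- `ψ` is a right integral
    (ψ : A →ₗ[ℂ] ℂ)
    (hψ_inv : ∀ a : A,
      (TensorProduct.lid ℂ A) ((TensorProduct.map ψ LinearMap.id) (comul (R := ℂ) a))
        = ψ a • (1 : A))
    (x x' y y' : A) :
    (TensorProduct.lid ℂ ℂ)
        ((TensorProduct.map ψ ψ)
          (((1 : A) ⊗ₜ[ℂ] (star y')) * comul (R := ℂ) (star x' * x) * ((1 : A) ⊗ₜ[ℂ] y)))
      = ψ (star x' * x) * ψ (star y' * y) := by
  have key : ∀ t : A ⊗[ℂ] A,
      (TensorProduct.lid ℂ ℂ)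
        ((TensorProduct.map ψ ψ) (((1 : A) ⊗ₜ[ℂ] (star y')) * t * ((1 : A) ⊗ₜ[ℂ] y)))
      = ψ (star y' * (TensorProduct.lid ℂ A) ((TensorProduct.map ψ LinearMap.id) t) * y) := by
    intro t
    induction t using TensorProduct.induction_on with
    | zero => simp
    | tmul a b => simp [Algebra.TensorProduct.tmul_mul_tmul]
    | add s t hs ht => simp only [mul_add, add_mul, map_add, hs, ht]
  rw [key, hψ_inv]
  simp
end
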